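/- arXiv:2111.15469 — 3 statements merged into one kernel-verified Lean document; each statement's English description precedes it below -/
import Mathlib

section
/- Let {f_n} be a sequence of nonnegative measurable functions on a probability space (Ω, F, P). Then there exist a measurable function f* : Ω → [0, ∞] and a strictly increasing sequence of indices n_1 < n_2 < ⋯ such that the subsequence {f_{n_k}} converges hereditarily in Cesàro mean to f*, P-a.e. -/
open MeasureTheory Filter Finset
open scoped ENNReal Topology

/-- Countably many bounded sequences in a real Hilbert space have a common weakly convergent
subsequence. -/
theorem exists_strictMono_forall_tendsto_inner {H : Type*} [NormedAddCommGroup H]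
    [InnerProductSpace ℝ H] [CompleteSpace H] (x : ℕ → ℕ → H) (B : ℕ → ℝ)
    (hB : ∀ M n, ‖x M n‖ ≤ B M) :
    ∃ (g : ℕ → H) (ψ : ℕ → ℕ), StrictMono ψ ∧
      ∀ M h, Tendsto (fun n => inner ℝ (x M (ψ n)) h) atTop (𝓝 (inner ℝ (g M) h)) := by
  have hB0 : ∀ M, 0 ≤ B M := fun M => (norm_nonneg _).trans (hB M 0)
  have hcomp : IsCompact (Set.pi Set.univ fun p : ℕ × ℕ × ℕ =>
      Set.Icc (-(B p.1 * B p.2.1)) (B p.1 * B p.2.1)) :=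
    isCompact_univ_pi fun _ => isCompact_Icc
  obtain ⟨L, -, ψ, hψ, hL⟩ := hcomp.tendsto_subseq
    (x := fun n (p : ℕ × ℕ × ℕ) => inner ℝ (x p.1 n) (x p.2.1 p.2.2)) (by
      intro n p _
      refine abs_le.1 ?_
      exact (abs_real_inner_le_norm _ _).trans
        (mul_le_mul (hB _ _) (hB _ _) (norm_nonneg _) (hB0 _)))
  rw [tendsto_pi_nhds] at hL
  set S : Submodule ℝ H := Submodule.span ℝ (Set.range fun q : ℕ × ℕ => x q.1 q.2)
  have hspan : ∀ M, ∀ h ∈ S, CauchySeq fun n => inner ℝ (x M (ψ n)) h := by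
    intro M h hh
    induction hh using Submodule.span_induction with
    | mem h hh =>
      obtain ⟨q, rfl⟩ := hh
      exact (hL (M, q.1, q.2)).cauchySeq
    | zero => simpa using cauchySeq_const (0 : ℝ)
    | add a b _ _ ha hb => 
      simp only [inner_add_right]
      exact ha.add hb
    | smul c a _ ha =>
      simp only [inner_smul_right]
      exact (uniformContinuous_const_smul c).comp_cauchySeq ha
  have hclos : ∀ M, ∀ h ∈ S.topologicalClosure, CauchySeq fun n => inner ℝ (x M (ψ n)) h := by
    intro M h hh
    rw [Metric.cauchySeq_iff]
    intro ε hε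
    have hBp : 0 < B M + 1 := by linarith [hB0 M]
    obtain ⟨h', hh', hd⟩ := Metric.mem_closure_iff.1 hh (ε / (3 * (B M + 1))) (by positivity)
    obtain ⟨N, hN⟩ := Metric.cauchySeq_iff.1 (hspan M h' hh') (ε / 3) (by positivity)
    have key : ∀ n, |inner ℝ (x M (ψ n)) h - inner ℝ (x M (ψ n)) h'| < ε / 3 := by
      intro n
      rw [← inner_sub_right]
      rw [dist_eq_norm] at hd
      calc _ ≤ ‖x M (ψ n)‖ * ‖h - h'‖ := abs_real_inner_le_norm _ _
        _ ≤ (B M + 1) * ‖h - h'‖ := by gcongr; linarith [hB M (ψ n)]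
        _ < (B M + 1) * (ε / (3 * (B M + 1))) := by gcongr
        _ = ε / 3 := by field_simp
    refine ⟨N, fun m hm n hn => ?_⟩
    have h1 := hN m hm n hn
    rw [Real.dist_eq] at h1 ⊢
    have h2 := key m
    have h3 := key n
    rw [abs_lt] at *
    constructor <;> linarith [h1.1, h1.2, h2.1, h2.2, h3.1, h3.2]
  have hall : ∀ M h, CauchySeq fun n => inner ℝ (x M (ψ n)) h := by
    intro M h
    obtain ⟨a, ha, b, hb, rfl⟩ := S.topologicalClosure.exists_add_mem_mem_orthogonal h
    have hx : ∀ n, inner ℝ (x M (ψ n)) b = 0 := fun n =>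
      (Submodule.mem_orthogonal _ _).1 hb _
        (S.le_topologicalClosure (Submodule.subset_span ⟨(M, ψ n), rfl⟩))
    simpa [inner_add_right, hx] using hclos M a ha
  choose ℓ hℓ using fun M h => cauchySeq_tendsto_of_complete (hall M h)
  refine ⟨fun M => (InnerProductSpace.toDual ℝ H).symm (continuousLinearMapOfTendsto
    (fun n => InnerProductSpace.toDual ℝ H (x M (ψ n))) (f := ℓ M) (l := atTop) ?_),
    ψ, hψ, fun M h => ?_⟩
  · rw [tendsto_pi_nhds]
    intro h
    simpa using hℓ M h
  · rw [InnerProductSpace.toDual_symm_apply]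
    exact hℓ M h

/-- Nonnegative functions with summable integrals tend to zero almost everywhere. -/
theorem ae_tendsto_zero_of_summable_integral {Ω : Type*} [MeasurableSpace Ω] {μ : Measure Ω}
    {F : ℕ → Ω → ℝ} (hint : ∀ n, Integrable (F n) μ) (hF : ∀ n ω, 0 ≤ F n ω)
    (hs : Summable fun n => ∫ ω, F n ω ∂μ) :
    ∀ᵐ ω ∂μ, Tendsto (fun n => F n ω) atTop (𝓝 0) := by
  have h1 : ∫⁻ ω, ∑' n, ENNReal.ofReal (F n ω) ∂μ ≠ ∞ := by
    rw [lintegral_tsum fun n => (hint n).aestronglyMeasurable.aemeasurable.ennreal_ofReal]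
    simp_rw [← fun n => ofReal_integral_eq_lintegral_ofReal (hint n) (ae_of_all _ (hF n))]
    exact hs.tsum_ofReal_ne_top
  have h2 := ae_lt_top' (AEMeasurable.tsum fun n =>
    (hint n).aestronglyMeasurable.aemeasurable.ennreal_ofReal) h1
  filter_upwards [h2] with ω hω
  have h3 := (ENNReal.tendsto_toReal ENNReal.zero_ne_top).comp
    (ENNReal.tendsto_atTop_zero_of_tsum_ne_top hω.ne)
  simpa [Function.comp_def, hF] using h3

/-- Kronecker-type summability along a geometric sequence of indices. -/
theorem summable_sum_range_floor_pow_div_sq {u : ℕ → ℝ} (hu : ∀ k, 0 ≤ u k)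
    (hs : Summable fun k : ℕ => u k / ((k : ℝ) + 1) ^ 2) {c : ℝ} (hc : 1 < c) :
    Summable fun m : ℕ => (∑ k ∈ range ⌊c ^ m⌋₊, u k) / (⌊c ^ m⌋₊ : ℝ) ^ 2 := by
  set C : ℝ := c ^ 5 * (c - 1)⁻¹ ^ 3
  have hC : 0 ≤ C := by
    have : 0 < c - 1 := sub_pos.2 hc
    positivity
  refine summable_of_sum_range_le (c := 4 * C * ∑' k : ℕ, u k / ((k : ℝ) + 1) ^ 2)
    (fun m => div_nonneg (sum_nonneg fun k _ => hu k) (sq_nonneg _)) fun N => ?_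
  set T := ∑ m ∈ range N, ⌊c ^ m⌋₊
  have hT : ∀ m ∈ range N, ⌊c ^ m⌋₊ ≤ T := fun m hm =>
    single_le_sum (f := fun m => ⌊c ^ m⌋₊) (fun _ _ => Nat.zero_le _) hm
  calc ∑ m ∈ range N, (∑ k ∈ range ⌊c ^ m⌋₊, u k) / (⌊c ^ m⌋₊ : ℝ) ^ 2
      = ∑ m ∈ range N, ∑ k ∈ range T,
          if (k : ℝ) + 1 / 2 < (⌊c ^ m⌋₊ : ℝ) then u k * (1 / (⌊c ^ m⌋₊ : ℝ) ^ 2) else 0 := by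
        refine sum_congr rfl fun m hm => ?_
        rw [sum_div, ← sum_filter]
        refine sum_congr ?_ fun k _ => by ring
        ext k
        simp only [mem_range, mem_filter]
        constructor
        · intro h
          refine ⟨h.trans_le (hT m hm), ?_⟩
          have : (k : ℝ) + 1 ≤ (⌊c ^ m⌋₊ : ℝ) := by exact_mod_cast h
          linarith
        · rintro ⟨-, h⟩
          have : (k : ℝ) < (⌊c ^ m⌋₊ : ℝ) := by linarith
          exact_mod_cast this
    _ = ∑ k ∈ range T, u k *
          ∑ m ∈ range N with (k : ℝ) + 1 / 2 < (⌊c ^ m⌋₊ : ℝ), 1 / (⌊c ^ m⌋₊ : ℝ) ^ 2 := by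
        rw [sum_comm]
        refine sum_congr rfl fun k _ => ?_
        rw [mul_sum, sum_filter]
    _ ≤ ∑ k ∈ range T, 4 * C * (u k / ((k : ℝ) + 1) ^ 2) := by
        refine sum_le_sum fun k _ => ?_
        calc u k * _ ≤ u k * (C / ((k : ℝ) + 1 / 2) ^ 2) :=
              mul_le_mul_of_nonneg_left
                (sum_div_nat_floor_pow_sq_le_div_sq N (by positivity) hc) (hu k)
          _ ≤ u k * (C / (((k : ℝ) + 1) / 2) ^ 2) := by
              have := hu k
              gcongr
              linarith [(Nat.cast_nonneg k : (0 : ℝ) ≤ k)]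
          _ = 4 * C * (u k / ((k : ℝ) + 1) ^ 2) := by field_simp; norm_num
    _ ≤ 4 * C * ∑' k : ℕ, u k / ((k : ℝ) + 1) ^ 2 := by
        rw [← mul_sum]
        refine mul_le_mul_of_nonneg_left ?_ (by positivity)
        exact hs.sum_le_tsum _ fun k _ => div_nonneg (hu k) (sq_nonneg _)

/-- A strong law of large numbers for nonnegative functions `Y k` whose deviations from `G k` are
almost orthogonal in `L²`. -/
theorem ae_tendsto_average_of_almost_orthogonal {Ω : Type*} [MeasurableSpace Ω] {μ : Measure Ω}
    {Y G : ℕ → Ω → ℝ} {g : Ω → ℝ} (hY : ∀ k ω, 0 ≤ Y k ω)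
    (hL : ∀ k, MemLp (fun ω => Y k ω - G k ω) 2 μ)
    (hv : Summable fun k : ℕ => (∫ ω, (Y k ω - G k ω) ^ 2 ∂μ) / ((k : ℝ) + 1) ^ 2)
    (hc : ∀ i k, i < k → ∫ ω, (Y i ω - G i ω) * (Y k ω - G k ω) ∂μ ≤ (1 / 2) ^ k)
    (hG : ∀ᵐ ω ∂μ, Tendsto (fun K : ℕ => (∑ k ∈ range K, G k ω) / K) atTop (𝓝 (g ω))) :
    ∀ᵐ ω ∂μ, Tendsto (fun K : ℕ => (∑ k ∈ range K, Y k ω) / K) atTop (𝓝 (g ω)) := by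
  set Z : ℕ → Ω → ℝ := fun k ω => Y k ω - G k ω
  set u : ℕ → ℝ := fun k => (∫ ω, Z k ω ^ 2 ∂μ) + 2 * (k * (1 / 2) ^ k)
  have hu : ∀ k, 0 ≤ u k := fun k =>
    add_nonneg (integral_nonneg fun ω => sq_nonneg _) (by positivity)
  have hus : Summable fun k : ℕ => u k / ((k : ℝ) + 1) ^ 2 := by
    have h1 : Summable fun k : ℕ => 2 * ((k : ℝ) * (1 / 2) ^ k) := by
      have := summable_pow_mul_geometric_of_norm_lt_one (R := ℝ) 1 (r := 1 / 2) (by norm_num)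
      simpa using this.mul_left 2
    refine (hv.add h1).of_nonneg_of_le (fun k => div_nonneg (hu k) (sq_nonneg _)) fun k => ?_
    rw [add_div]
    gcongr
    exact div_le_self (by positivity) (one_le_pow₀ (by linarith [(Nat.cast_nonneg k : (0 : ℝ) ≤ k)]))
  have hSL : ∀ K, MemLp (fun ω => ∑ k ∈ range K, Z k ω) 2 μ := fun K =>
    memLp_finsetSum _ fun k _ => hL k
  have hI : ∀ i k, Integrable (fun ω => Z i ω * Z k ω) μ := fun i k =>
    (hL i).integrable_mul (hL k)
  have hSu : ∀ K, ∫ ω, (∑ k ∈ range K, Z k ω) ^ 2 ∂μ ≤ ∑ k ∈ range K, u k := by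
    intro K
    induction K with
    | zero => simp
    | succ K ih =>
      have h1 : Integrable (fun ω => (∑ k ∈ range K, Z k ω) * Z K ω) μ :=
        (hSL K).integrable_mul (hL K)
      have h2 : ∫ ω, (∑ k ∈ range K, Z k ω) * Z K ω ∂μ ≤ K * (1 / 2) ^ K := by
        simp_rw [sum_mul]
        rw [integral_finsetSum _ fun k _ => hI k K]
        calc _ ≤ ∑ k ∈ range K, (1 / 2 : ℝ) ^ K :=
              sum_le_sum fun k hk => hc k K (mem_range.1 hk)
          _ = _ := by simp
      have h4 : Integrable (fun ω => (∑ k ∈ range K, Z k ω) ^ 2) μ := (hSL K).integrable_sq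
      have h5 : Integrable (fun ω => Z K ω ^ 2) μ := (hL K).integrable_sq
      have h6 : Integrable (fun ω => (∑ k ∈ range K, Z k ω) ^ 2 +
          2 * ((∑ k ∈ range K, Z k ω) * Z K ω)) μ := h4.add (h1.const_mul 2)
      have h3 : (fun ω => (∑ k ∈ range (K + 1), Z k ω) ^ 2) = fun ω =>
          ((∑ k ∈ range K, Z k ω) ^ 2 + 2 * ((∑ k ∈ range K, Z k ω) * Z K ω)) + Z K ω ^ 2 := by
        ext ω
        rw [sum_range_succ]
        ring
      rw [h3, integral_add h6 h5,
        integral_add h4 (h1.const_mul 2), integral_const_mul, sum_range_succ]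
      simp only [u]
      linarith
  have hlac : ∀ c : ℝ, 1 < c → ∀ᵐ ω ∂μ, Tendsto
      (fun m : ℕ => (∑ k ∈ range ⌊c ^ m⌋₊, Z k ω) / (⌊c ^ m⌋₊ : ℝ)) atTop (𝓝 0) := by
    intro c hc1
    have h1 := ae_tendsto_zero_of_summable_integral (μ := μ)
      (F := fun m ω => (∑ k ∈ range ⌊c ^ m⌋₊, Z k ω) ^ 2 / (⌊c ^ m⌋₊ : ℝ) ^ 2)
      (fun m => (hSL _).integrable_sq.div_const _) (fun m ω => by positivity)
      ((summable_sum_range_floor_pow_div_sq hu hus hc1).of_nonneg_of_le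
        (fun m => integral_nonneg fun ω => by positivity) fun m => by
          rw [integral_div]
          gcongr
          exact hSu _)
    filter_upwards [h1] with ω hω
    rw [tendsto_zero_iff_abs_tendsto_zero]
    have h2 := (Real.continuous_sqrt.tendsto 0).comp hω
    simpa [Function.comp_def, ← div_pow, Real.sqrt_sq_eq_abs] using h2
  have hlac' : ∀ᵐ ω ∂μ, ∀ j : ℕ, Tendsto (fun m : ℕ =>
      (∑ k ∈ range ⌊(1 + 1 / ((j : ℝ) + 1)) ^ m⌋₊, Z k ω) /
        (⌊(1 + 1 / ((j : ℝ) + 1)) ^ m⌋₊ : ℝ)) atTop (𝓝 0) :=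
    ae_all_iff.2 fun j => hlac _ (by have : 0 < 1 / ((j : ℝ) + 1) := by positivity
                                     linarith)
  filter_upwards [hlac', hG] with ω h1 h2
  refine tendsto_div_of_monotone_of_tendsto_div_floor_pow (fun K => ∑ k ∈ range K, Y k ω) (g ω)
    (fun a b hab => sum_le_sum_of_subset_of_nonneg (range_mono hab) fun k _ _ => hY k ω)
    (fun j => 1 + 1 / ((j : ℝ) + 1))
    (fun j => by have : 0 < 1 / ((j : ℝ) + 1) := by positivity
                 linarith)
    (by simpa using (tendsto_one_div_add_atTop_nhds_zero_nat (𝕜 := ℝ)).const_add 1) fun j => ?_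
  have hK : Tendsto (fun m : ℕ => ⌊(1 + 1 / ((j : ℝ) + 1)) ^ m⌋₊) atTop atTop :=
    tendsto_nat_floor_atTop.comp (tendsto_pow_atTop_atTop_of_one_lt
      (by have : 0 < 1 / ((j : ℝ) + 1) := by positivity
          linarith))
  have h3 := (h1 j).add (h2.comp hK)
  simp only [zero_add] at h3
  refine h3.congr fun m => ?_
  simp only [Function.comp_apply, Z, sum_sub_distrib]
  ring

theorem L2.real_inner_toLp {Ω : Type*} [MeasurableSpace Ω] {μ : Measure Ω} {a b : Ω → ℝ}
    (ha : MemLp a 2 μ) (hb : MemLp b 2 μ) :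
    inner ℝ (ha.toLp a) (hb.toLp b) = ∫ ω, a ω * b ω ∂μ := by
  rw [L2.inner_def]
  refine integral_congr_ae ?_
  filter_upwards [ha.coeFn_toLp, hb.coeFn_toLp] with ω h1 h2
  simp [h1, h2, mul_comm]

theorem abs_min_natCast_le {x : ℝ} (hx : 0 ≤ x) (M : ℕ) : |min x (M : ℝ)| ≤ M := by
  rw [abs_of_nonneg (le_min hx (Nat.cast_nonneg M))]
  exact min_le_right _ _

/-- Along a common subsequence, all truncations `min (f n) M` of a sequence of nonnegative
functions converge weakly. -/
theorem exists_weak_limit_truncations {Ω : Type*} [MeasurableSpace Ω] (P : Measure Ω)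
    [IsFiniteMeasure P] (f : ℕ → Ω → ℝ)
    (hmeas : ∀ n, Measurable (f n)) (hpos : ∀ n ω, 0 ≤ f n ω) :
    ∃ (g : ℕ → Ω → ℝ) (ψ : ℕ → ℕ), StrictMono ψ ∧ (∀ M, Measurable (g M)) ∧
      (∀ M ω, 0 ≤ g M ω) ∧ (∀ (M : ℕ) ω, g M ω ≤ M) ∧ (∀ ω, Monotone fun M => g M ω) ∧
      ∀ (M : ℕ) (h : Ω → ℝ), Measurable h → (∃ C, ∀ ω, |h ω| ≤ C) →
        Tendsto (fun n => ∫ ω, min (f (ψ n) ω) M * h ω ∂P) atTop (𝓝 (∫ ω, g M ω * h ω ∂P)) := by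
  have hLp : ∀ M n : ℕ, MemLp (fun ω => min (f n ω) (M : ℝ)) 2 P := fun M n =>
    MemLp.of_bound ((hmeas n).min measurable_const).aestronglyMeasurable (M : ℝ)
      (ae_of_all _ fun ω => abs_min_natCast_le (hpos n ω) M)
  obtain ⟨γ, ψ, hψ, hγ⟩ := exists_strictMono_forall_tendsto_inner
    (fun M n => (hLp M n).toLp _)
    (fun M => (measureUnivNNReal P : ℝ) ^ (ENNReal.toReal 2)⁻¹ * M) (fun M n => by
      refine Lp.norm_le_of_ae_bound (Nat.cast_nonneg M) ?_
      filter_upwards [(hLp M n).coeFn_toLp] with ω hω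
      rw [hω]
      exact abs_min_natCast_le (hpos n ω) M)
  have hγL : ∀ M, MemLp (γ M : Ω → ℝ) 2 P := fun M => Lp.memLp _
  have hγi : ∀ M, Integrable (γ M : Ω → ℝ) P := fun M => (hγL M).integrable one_le_two
  have hweak : ∀ (M : ℕ) (h : Ω → ℝ), Measurable h → (∃ C, ∀ ω, |h ω| ≤ C) →
      Tendsto (fun n => ∫ ω, min (f (ψ n) ω) M * h ω ∂P) atTop (𝓝 (∫ ω, γ M ω * h ω ∂P)) := by
    rintro M h hh ⟨C, hC⟩
    have hhL : MemLp h 2 P := MemLp.of_bound hh.aestronglyMeasurable C (ae_of_all _ hC)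
    have h1 := hγ M (hhL.toLp h)
    rw [← Lp.toLp_coeFn (γ M) (hγL M)] at h1
    simpa only [L2.real_inner_toLp] using h1
  have hset : ∀ (M : ℕ) (s : Set Ω), MeasurableSet s →
      Tendsto (fun n => ∫ ω in s, min (f (ψ n) ω) M ∂P) atTop (𝓝 (∫ ω in s, γ M ω ∂P)) := by
    intro M s hs
    have h1 := hweak M (s.indicator 1) (measurable_one.indicator hs)
      ⟨1, fun ω => by by_cases hω : ω ∈ s <;> simp [hω]⟩
    have h2 : ∀ F : Ω → ℝ, ∫ ω, F ω * s.indicator 1 ω ∂P = ∫ ω in s, F ω ∂P := by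
      intro F
      rw [← integral_indicator hs]
      congr 1
      ext ω
      by_cases hω : ω ∈ s <;> simp [hω]
    simpa only [h2] using h1
  have hmi : ∀ M n : ℕ, Integrable (fun ω => min (f n ω) (M : ℝ)) P := fun M n =>
    (hLp M n).integrable one_le_two
  have h0 : ∀ M, 0 ≤ᵐ[P] γ M := fun M =>
    ae_nonneg_of_forall_setIntegral_nonneg (hγi M) fun s hs _ =>
      ge_of_tendsto' (hset M s hs) fun n =>
        integral_nonneg fun ω => le_min (hpos _ ω) (Nat.cast_nonneg M)
  have h1 : ∀ M : ℕ, γ M ≤ᵐ[P] fun _ => (M : ℝ) := fun M =>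
    ae_le_of_forall_setIntegral_le (hγi M) (integrable_const _) fun s hs _ =>
      le_of_tendsto' (hset M s hs) fun n =>
        integral_mono (hmi M _).integrableOn (integrable_const _) fun ω => min_le_right _ _
  have h2 : ∀ M : ℕ, γ M ≤ᵐ[P] γ (M + 1) := fun M =>
    ae_le_of_forall_setIntegral_le (hγi M) (hγi (M + 1)) fun s hs _ =>
      le_of_tendsto_of_tendsto' (hset M s hs) (hset (M + 1) s hs) fun n =>
        integral_mono (hmi M _).integrableOn (hmi (M + 1) _).integrableOn fun ω =>
          min_le_min_left _ (by simp)
  have hgood : ∀ᵐ ω ∂P, ∀ M : ℕ, 0 ≤ γ M ω ∧ γ M ω ≤ M ∧ γ M ω ≤ γ (M + 1) ω := by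
    rw [ae_all_iff]
    intro M
    filter_upwards [h0 M, h1 M, h2 M] with ω a b c using ⟨a, b, c⟩
  have hsm : ∀ M, Measurable (γ M : Ω → ℝ) := fun M => (Lp.stronglyMeasurable (γ M)).measurable
  set A : Set Ω := {ω | ∀ M : ℕ, 0 ≤ γ M ω ∧ γ M ω ≤ M ∧ γ M ω ≤ γ (M + 1) ω}
  have hA : MeasurableSet A := by
    have : A = ⋂ M : ℕ, {ω | 0 ≤ γ M ω} ∩ ({ω | γ M ω ≤ M} ∩ {ω | γ M ω ≤ γ (M + 1) ω}) := by
      ext ω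
      simp [A]
    rw [this]
    exact MeasurableSet.iInter fun M => (measurableSet_le measurable_const (hsm M)).inter
      ((measurableSet_le (hsm M) measurable_const).inter (measurableSet_le (hsm M) (hsm _)))
  refine ⟨fun M => A.indicator (γ M), ψ, hψ, fun M => (hsm M).indicator hA,
    fun M ω => ?_, fun M ω => ?_, fun ω => ?_, fun M h hh hC => ?_⟩
  · exact Set.indicator_apply_nonneg fun hω => (hω M).1
  · exact Set.indicator_apply_le' (fun hω => (hω M).2.1) fun _ => Nat.cast_nonneg M
  · by_cases hω : ω ∈ A
    · simp only [hω, Set.indicator_of_mem]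
      exact monotone_nat_of_le_succ fun M => (hω M).2.2
    · simp only [hω, not_false_eq_true, Set.indicator_of_notMem]
      exact monotone_const
  · convert hweak M h hh hC using 2
    refine integral_congr_ae ?_
    filter_upwards [hgood] with ω hω
    rw [Set.indicator_of_mem (show ω ∈ A from hω)]

theorem exists_strictMono_of_forall_eventually {p : ℕ → ℕ → Prop}
    (hp : ∀ B, ∀ᶠ y in atTop, p B y) :
    ∃ n : ℕ → ℕ, StrictMono n ∧ ∀ k, ∃ B ≥ k, p B (n k) ∧ ∀ i < k, n i ≤ B := by
  have h1 : ∀ B, ∃ y, B < y ∧ p B y := fun B => ((eventually_gt_atTop B).and (hp B)).exists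
  choose T hT hpT using h1
  have hmono : StrictMono fun k => T^[k] 0 := strictMono_nat_of_lt_succ fun k => by
    rw [Function.iterate_succ_apply']
    exact hT _
  refine ⟨fun k => T^[k + 1] 0, fun a b hab => hmono (Nat.succ_lt_succ hab), fun k =>
    ⟨T^[k] 0, hmono.le_apply, ?_, fun i hi => hmono.monotone hi⟩⟩
  simp only [Function.iterate_succ_apply']
  exact hpT _

/-- The truncations `min (X k) M` have the limits `g M`, with errors that are quantitatively small
in mean and almost orthogonal to the errors of earlier terms. -/
structure IsAlmostOrthogonal {Ω : Type*} [MeasurableSpace Ω] (μ : Measure Ω)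
    (X g : ℕ → Ω → ℝ) : Prop where
  measurable_X : ∀ k, Measurable (X k)
  X_nonneg : ∀ k ω, 0 ≤ X k ω
  measurable_g : ∀ M, Measurable (g M)
  g_nonneg : ∀ M ω, 0 ≤ g M ω
  g_le : ∀ (M : ℕ) ω, g M ω ≤ M
  g_mono : ∀ ω, Monotone fun M => g M ω
  cross : ∀ i k, i < k → ∀ M ≤ k + 1, ∀ M' ≤ k + 1,
    ∫ ω, (min (X i ω) (M' : ℕ) - g M' ω) * (min (X k ω) (M : ℕ) - g M ω) ∂μ ≤ (1 / 2) ^ k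
  mean : ∀ k, ∀ M ≤ k + 1,
    |(∫ ω, min (X k ω) (M : ℕ) ∂μ) - ∫ ω, g M ω ∂μ| ≤ (1 / 2) ^ k

theorem sq_le_sum_range_mul_sub {a : ℕ → ℝ} (h0 : a 0 = 0) (ha : ∀ j, a j ≤ j) (hm : Monotone a)
    (N : ℕ) : a N ^ 2 ≤ ∑ j ∈ range N, (2 * (j : ℝ) + 1) * (a (j + 1) - a j) := by
  induction N with
  | zero => simp [h0]
  | succ N ih =>
    rw [sum_range_succ]
    have h1 := ha N
    have h2 := ha (N + 1)
    have h3 := hm (Nat.le_succ N)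
    push_cast at h2
    nlinarith [mul_nonneg (sub_nonneg.2 h3) (show 0 ≤ 2 * (N : ℝ) + 1 - (a (N + 1) + a N) by
      linarith)]

theorem summable_sum_range_odd_mul_div_sq {e : ℕ → ℝ} (he : ∀ j, 0 ≤ e j) (hs : Summable e) :
    Summable fun k : ℕ =>
      (∑ j ∈ range (k + 1), (2 * (j : ℝ) + 1) * e j) / ((k : ℝ) + 1) ^ 2 := by
  refine summable_of_sum_range_le (c := 4 * ∑' j, e j)
    (fun k => div_nonneg (sum_nonneg fun j _ => mul_nonneg (by positivity) (he j)) (sq_nonneg _))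
    fun N => ?_
  calc ∑ k ∈ range N, (∑ j ∈ range (k + 1), (2 * (j : ℝ) + 1) * e j) / ((k : ℝ) + 1) ^ 2
      = ∑ j ∈ range N, (2 * (j : ℝ) + 1) * e j * ∑ k ∈ Ico j N, (((k + 1 : ℕ) : ℝ) ^ 2)⁻¹ := by
        simp_rw [mul_sum, sum_div, div_eq_mul_inv, range_eq_Ico]
        rw [sum_Ico_Ico_comm]
        push_cast
        rfl
    _ ≤ ∑ j ∈ range N, 4 * e j := by
        refine sum_le_sum fun j _ => ?_
        have h1 : ∑ k ∈ Ico j N, (((k + 1 : ℕ) : ℝ) ^ 2)⁻¹ ≤ 2 / ((j : ℝ) + 1) := by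
          rw [sum_Ico_add' (fun i : ℕ => ((i : ℝ) ^ 2)⁻¹) j N 1]
          have h2 : Ico (j + 1) (N + 1) = Ioo j (N + 1) := by
            ext i
            simp only [mem_Ico, mem_Ioo]
            omega
          rw [h2]
          exact sum_Ioo_inv_sq_le j (N + 1)
        have hj : (0 : ℝ) ≤ j := Nat.cast_nonneg j
        have hej := he j
        calc _ ≤ (2 * (j : ℝ) + 1) * e j * (2 / ((j : ℝ) + 1)) := by gcongr
          _ ≤ (2 * ((j : ℝ) + 1)) * e j * (2 / ((j : ℝ) + 1)) := by gcongr; linarith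
          _ = 4 * e j := by field_simp; ring
    _ ≤ 4 * ∑' j, e j := by
        rw [← mul_sum]
        gcongr
        exact hs.sum_le_tsum _ fun j _ => he j

theorem summable_const_div_add_one_sq (c : ℝ) :
    Summable fun k : ℕ => c / ((k : ℝ) + 1) ^ 2 := by
  have h1 := (summable_nat_add_iff 1).2 (Real.summable_one_div_nat_pow.2 one_lt_two)
  simpa [div_eq_mul_inv] using h1.mul_left c

theorem sum_range_odd (k : ℕ) : ∑ j ∈ range k, (2 * (j : ℝ) + 1) = (k : ℝ) ^ 2 := by
  induction k with
  | zero => simp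
  | succ k ih => rw [sum_range_succ, ih]; push_cast; ring

namespace IsAlmostOrthogonal

variable {Ω : Type*} [MeasurableSpace Ω] {μ : Measure Ω} {X g : ℕ → Ω → ℝ}

theorem comp (h : IsAlmostOrthogonal μ X g) {φ : ℕ → ℕ} (hφ : StrictMono φ) :
    IsAlmostOrthogonal μ (fun k => X (φ k)) g where
  measurable_X k := h.measurable_X _
  X_nonneg k := h.X_nonneg _
  measurable_g := h.measurable_g
  g_nonneg := h.g_nonneg
  g_le := h.g_le
  g_mono := h.g_mono
  cross i k hik M hM M' hM' := by
    have hk : k ≤ φ k := hφ.le_apply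
    exact (h.cross (φ i) (φ k) (hφ hik) M (by omega) M' (by omega)).trans
      (pow_le_pow_of_le_one (by norm_num) (by norm_num) hk)
  mean k M hM := by
    have hk : k ≤ φ k := hφ.le_apply
    exact (h.mean (φ k) M (by omega)).trans
      (pow_le_pow_of_le_one (by norm_num) (by norm_num) hk)

theorem memLp_min [IsFiniteMeasure μ] (h : IsAlmostOrthogonal μ X g) (k M : ℕ) :
    MemLp (fun ω => min (X k ω) (M : ℝ)) 2 μ :=
  MemLp.of_bound ((h.measurable_X k).min measurable_const).aestronglyMeasurable (M : ℝ)
    (ae_of_all _ fun ω => abs_min_natCast_le (h.X_nonneg k ω) M)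

theorem memLp_g [IsFiniteMeasure μ] (h : IsAlmostOrthogonal μ X g) (M : ℕ) :
    MemLp (g M) 2 μ :=
  MemLp.of_bound (h.measurable_g M).aestronglyMeasurable (M : ℝ)
    (ae_of_all _ fun ω => by
      rw [Real.norm_of_nonneg (h.g_nonneg M ω)]
      exact h.g_le M ω)

theorem integrable_min [IsFiniteMeasure μ] (h : IsAlmostOrthogonal μ X g) (k M : ℕ) :
    Integrable (fun ω => min (X k ω) (M : ℝ)) μ :=
  (h.memLp_min k M).integrable one_le_two

theorem integrable_g [IsFiniteMeasure μ] (h : IsAlmostOrthogonal μ X g) (M : ℕ) :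
    Integrable (g M) μ :=
  (h.memLp_g M).integrable one_le_two

theorem ae_tendsto_average_min [IsFiniteMeasure μ] (h : IsAlmostOrthogonal μ X g) {c : ℕ → ℕ}
    (hc : ∀ k, c k ≤ k + 1) (hmono : Monotone c) {G : Ω → ℝ}
    (hv : Summable fun k : ℕ =>
      (∫ ω, (min (X k ω) (c k : ℝ) - g (c k) ω) ^ 2 ∂μ) / ((k : ℝ) + 1) ^ 2)
    (hG : ∀ᵐ ω ∂μ, Tendsto (fun k => g (c k) ω) atTop (𝓝 (G ω))) :
    ∀ᵐ ω ∂μ, Tendsto (fun K : ℕ => (∑ k ∈ range K, min (X k ω) (c k : ℝ)) / K) atTop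
      (𝓝 (G ω)) := by
  refine ae_tendsto_average_of_almost_orthogonal (G := fun k => g (c k))
    (fun k ω => le_min (h.X_nonneg k ω) (Nat.cast_nonneg _))
    (fun k => (h.memLp_min k (c k)).sub (h.memLp_g (c k))) hv
    (fun i k hik => h.cross i k hik _ (hc k) _ ((hmono hik.le).trans (hc k))) ?_
  filter_upwards [hG] with ω hω
  simpa only [div_eq_inv_mul] using hω.cesaro

/-- The averages of the truncations at level `M` converge to `g M`. -/
theorem ae_tendsto_average_min_const [IsFiniteMeasure μ] (h : IsAlmostOrthogonal μ X g)
    (M : ℕ) :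
    ∀ᵐ ω ∂μ, Tendsto (fun K : ℕ => (∑ k ∈ range K, min (X k ω) ((min M (k + 1) : ℕ) : ℝ)) / K)
      atTop (𝓝 (g M ω)) := by
  refine h.ae_tendsto_average_min (c := fun k => min M (k + 1)) (fun k => min_le_right _ _)
    (fun a b hab => min_le_min_left _ (by omega)) ?_ (ae_of_all _ fun ω => ?_)
  · refine (summable_const_div_add_one_sq ((M : ℝ) ^ 2 * μ.real Set.univ)).of_nonneg_of_le
      (fun k => div_nonneg (integral_nonneg fun ω => sq_nonneg _) (sq_nonneg _)) fun k => ?_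
    gcongr
    calc _ ≤ ∫ ω, (M : ℝ) ^ 2 ∂μ := by
          refine integral_mono
            ((h.memLp_min k _).sub (h.memLp_g _)).integrable_sq (integrable_const _) fun ω => ?_
          have h1 := le_min (h.X_nonneg k ω) (Nat.cast_nonneg (α := ℝ) (min M (k + 1)))
          have h2 := min_le_right (X k ω) ((min M (k + 1) : ℕ) : ℝ)
          have h3 := h.g_nonneg (min M (k + 1)) ω
          have h4 := h.g_le (min M (k + 1)) ω
          have h5 : ((min M (k + 1) : ℕ) : ℝ) ≤ M := by exact_mod_cast min_le_left _ _
          exact sq_le_sq' (by linarith) (by linarith)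
      _ = _ := by simp [mul_comm]
  · refine tendsto_const_nhds.congr' ?_
    filter_upwards [eventually_ge_atTop M] with k hk
    rw [min_eq_left (by omega)]

/-- If the truncated limits `g M` are bounded in mean, then the averages of `X` converge to the
limit of `g M`. -/
theorem ae_tendsto_average [IsFiniteMeasure μ] (h : IsAlmostOrthogonal μ X g) {C : ℝ}
    (hC : ∀ M, ∫ ω, g M ω ∂μ ≤ C) {G : Ω → ℝ}
    (hG : ∀ᵐ ω ∂μ, Tendsto (fun M => g M ω) atTop (𝓝 (G ω))) :
    ∀ᵐ ω ∂μ, Tendsto (fun K : ℕ => (∑ k ∈ range K, X k ω) / K) atTop (𝓝 (G ω)) := by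
  set e : ℕ → ℝ := fun j => (∫ ω, g (j + 1) ω ∂μ) - ∫ ω, g j ω ∂μ
  have he : ∀ j, 0 ≤ e j := fun j => sub_nonneg.2 <|
    integral_mono (h.integrable_g j) (h.integrable_g (j + 1)) fun ω => h.g_mono ω (Nat.le_succ j)
  have hes : Summable e := summable_of_sum_range_le (c := C) he fun N => by
    rw [sum_range_sub (fun j => ∫ ω, g j ω ∂μ)]
    linarith [hC N, integral_nonneg (μ := μ) (f := g 0) fun ω => h.g_nonneg 0 ω]
  have hdi : ∀ k j : ℕ,
      Integrable (fun ω => min (X k ω) ((j + 1 : ℕ) : ℝ) - min (X k ω) (j : ℝ)) μ := fun k j =>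
    (h.integrable_min k (j + 1)).sub (h.integrable_min k j)
  have hd : ∀ k : ℕ, ∀ j ≤ k,
      ∫ ω, (min (X k ω) ((j + 1 : ℕ) : ℝ) - min (X k ω) (j : ℝ)) ∂μ ≤ e j + 2 * (1 / 2) ^ k := by
    intro k j hj
    rw [integral_sub (h.integrable_min k (j + 1)) (h.integrable_min k j)]
    have h1 := abs_le.1 (h.mean k (j + 1) (by omega))
    have h2 := abs_le.1 (h.mean k j (by omega))
    simp only [e]
    linarith [h1.2, h2.1]
  have hgeo : Summable fun k : ℕ => (1 / 2 : ℝ) ^ k := summable_geometric_two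
  have hv : Summable fun k : ℕ =>
      (∫ ω, (min (X k ω) ((k + 1 : ℕ) : ℝ) - g (k + 1) ω) ^ 2 ∂μ) / ((k : ℝ) + 1) ^ 2 := by
    refine (((summable_sum_range_odd_mul_div_sq he hes).mul_left 4).add
      (hgeo.mul_left 4)).of_nonneg_of_le
      (fun k => div_nonneg (integral_nonneg fun ω => sq_nonneg _) (sq_nonneg _)) fun k => ?_
    have hpt : ∀ ω, (min (X k ω) ((k + 1 : ℕ) : ℝ) - g (k + 1) ω) ^ 2 ≤
        ∑ j ∈ range (k + 1), (2 * (2 * (j : ℝ) + 1)) *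
          ((min (X k ω) ((j + 1 : ℕ) : ℝ) - min (X k ω) (j : ℝ)) + (g (j + 1) ω - g j ω)) := by
      intro ω
      have h1 := sq_le_sum_range_mul_sub (a := fun j => min (X k ω) (j : ℝ))
        (by simp [h.X_nonneg k ω]) (fun j => min_le_right _ _)
        (fun a b hab => min_le_min_left _ (by exact_mod_cast hab)) (k + 1)
      have h2 := sq_le_sum_range_mul_sub (a := fun j => g j ω)
        (le_antisymm (by simpa using h.g_le 0 ω) (h.g_nonneg 0 ω)) (fun j => h.g_le j ω)
        (h.g_mono ω) (k + 1)
      have h3 : ∑ j ∈ range (k + 1), (2 * (2 * (j : ℝ) + 1)) *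
          ((min (X k ω) ((j + 1 : ℕ) : ℝ) - min (X k ω) (j : ℝ)) + (g (j + 1) ω - g j ω)) =
          2 * (∑ j ∈ range (k + 1), (2 * (j : ℝ) + 1) *
            (min (X k ω) ((j + 1 : ℕ) : ℝ) - min (X k ω) (j : ℝ))) +
          2 * ∑ j ∈ range (k + 1), (2 * (j : ℝ) + 1) * (g (j + 1) ω - g j ω) := by
        rw [mul_sum, mul_sum, ← sum_add_distrib]
        exact sum_congr rfl fun j _ => by ring
      rw [h3]
      nlinarith [sq_nonneg (min (X k ω) ((k + 1 : ℕ) : ℝ) + g (k + 1) ω)]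
    have hgi : ∀ j, Integrable (fun ω => g (j + 1) ω - g j ω) μ := fun j =>
      (h.integrable_g (j + 1)).sub (h.integrable_g j)
    have hsi : ∀ j : ℕ, Integrable (fun ω => (2 * (2 * (j : ℝ) + 1)) *
          ((min (X k ω) ((j + 1 : ℕ) : ℝ) - min (X k ω) (j : ℝ)) + (g (j + 1) ω - g j ω))) μ :=
      fun j => ((hdi k j).add (hgi j)).const_mul _
    have hint : ∫ ω, (min (X k ω) ((k + 1 : ℕ) : ℝ) - g (k + 1) ω) ^ 2 ∂μ ≤
        4 * (∑ j ∈ range (k + 1), (2 * (j : ℝ) + 1) * e j) +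
          4 * (1 / 2) ^ k * ((k : ℝ) + 1) ^ 2 := by
      calc _ ≤ ∫ ω, ∑ j ∈ range (k + 1), (2 * (2 * (j : ℝ) + 1)) *
            ((min (X k ω) ((j + 1 : ℕ) : ℝ) - min (X k ω) (j : ℝ)) + (g (j + 1) ω - g j ω)) ∂μ :=
            integral_mono ((h.memLp_min k _).sub (h.memLp_g _)).integrable_sq
              (integrable_finsetSum _ fun j _ => hsi j) hpt
        _ ≤ ∑ j ∈ range (k + 1), (2 * (2 * (j : ℝ) + 1)) * (e j + 2 * (1 / 2) ^ k + e j) := by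
            rw [integral_finsetSum _ fun j _ => hsi j]
            refine sum_le_sum fun j hj => ?_
            rw [integral_const_mul, integral_add (hdi k j) (hgi j),
              integral_sub (h.integrable_g (j + 1)) (h.integrable_g j)]
            gcongr
            exact hd k j (by simpa [Nat.lt_succ_iff] using hj)
        _ = _ := by
            have h1 := sum_range_odd (k + 1)
            push_cast at h1
            rw [← h1, mul_sum, mul_sum, ← sum_add_distrib]
            exact sum_congr rfl fun j _ => by ring
    rw [div_le_iff₀ (by positivity)]
    refine hint.trans_eq ?_
    field_simp
  have hY := h.ae_tendsto_average_min (c := fun k => k + 1) (fun k => le_rfl)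
    (fun a b hab => by simpa using hab) hv
    (by filter_upwards [hG] with ω hω using hω.comp (tendsto_add_atTop_nat 1))
  have hd0 : ∀ᵐ ω ∂μ, Tendsto
      (fun k : ℕ => min (X k ω) ((k + 1 : ℕ) : ℝ) - min (X k ω) (k : ℝ)) atTop (𝓝 0) := by
    have hnn : ∀ (k : ℕ) ω, 0 ≤ min (X k ω) ((k + 1 : ℕ) : ℝ) - min (X k ω) (k : ℝ) :=
      fun k ω => sub_nonneg.2 (min_le_min_left _ (by simp))
    refine ae_tendsto_zero_of_summable_integral (fun k => hdi k k) hnn ?_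
    exact (hes.add (hgeo.mul_left 2)).of_nonneg_of_le (fun k => integral_nonneg (hnn k))
      fun k => hd k k le_rfl
  filter_upwards [hY, hd0] with ω h1 h2
  have h3 : Tendsto (fun k : ℕ => X k ω - min (X k ω) ((k + 1 : ℕ) : ℝ)) atTop (𝓝 0) := by
    refine tendsto_const_nhds.congr' ?_
    filter_upwards [h2.eventually_lt_const one_pos] with k hk
    by_cases hx : X k ω ≤ ((k + 1 : ℕ) : ℝ)
    · rw [min_eq_left hx, sub_self]
    · push Not at hx
      have hx' : (k : ℝ) ≤ X k ω := by
        push_cast at hx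
        linarith
      rw [min_eq_right hx.le, min_eq_right hx'] at hk
      push_cast at hk
      linarith
  have h4 := h1.add h3.cesaro
  rw [add_zero] at h4
  refine h4.congr fun K => ?_
  rw [sum_sub_distrib]
  ring

end IsAlmostOrthogonal

theorem eventually_almost_orthogonal {Ω : Type*} [MeasurableSpace Ω] {μ : Measure Ω}
    [IsFiniteMeasure μ] {f g : ℕ → Ω → ℝ} (hmeas : ∀ n, Measurable (f n))
    (hpos : ∀ n ω, 0 ≤ f n ω) (gmeas : ∀ M, Measurable (g M)) (gpos : ∀ M ω, 0 ≤ g M ω)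
    (gle : ∀ (M : ℕ) ω, g M ω ≤ M)
    (hw : ∀ (M : ℕ) (h : Ω → ℝ), Measurable h → (∃ C, ∀ ω, |h ω| ≤ C) →
      Tendsto (fun n => ∫ ω, min (f n ω) M * h ω ∂μ) atTop (𝓝 (∫ ω, g M ω * h ω ∂μ))) (B : ℕ) :
    ∀ᶠ y in atTop, ∀ x ≤ B, ∀ M ≤ B + 1, ∀ M' ≤ B + 1,
      ∫ ω, (min (f x ω) (M' : ℕ) - g M' ω) * (min (f y ω) (M : ℕ) - g M ω) ∂μ ≤ (1 / 2) ^ B ∧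
      |(∫ ω, min (f y ω) (M : ℕ) ∂μ) - ∫ ω, g M ω ∂μ| ≤ (1 / 2) ^ B := by
  have hpow : (0 : ℝ) < (1 / 2) ^ B := by positivity
  refine (eventually_all_finite (Set.finite_le_nat B)).2 fun x _ =>
    (eventually_all_finite (Set.finite_le_nat (B + 1))).2 fun M _ =>
      (eventually_all_finite (Set.finite_le_nat (B + 1))).2 fun M' _ => ?_
  have hm : ∀ y, AEStronglyMeasurable (fun ω => min (f y ω) (M : ℝ)) μ := fun y =>
    ((hmeas y).min measurable_const).aestronglyMeasurable
  have hmi : ∀ y, Integrable (fun ω => min (f y ω) (M : ℝ)) μ := fun y =>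
    Integrable.of_bound (hm y) M (ae_of_all _ fun ω => abs_min_natCast_le (hpos y ω) M)
  have hgi : Integrable (g M) μ :=
    Integrable.of_bound (gmeas M).aestronglyMeasurable M (ae_of_all _ fun ω => by
      rw [Real.norm_of_nonneg (gpos M ω)]
      exact gle M ω)
  have hZ : Measurable fun ω => min (f x ω) (M' : ℝ) - g M' ω :=
    ((hmeas x).min measurable_const).sub (gmeas M')
  have hZb : ∀ ω, |min (f x ω) (M' : ℝ) - g M' ω| ≤ M' := fun ω => by
    have h1 := le_min (hpos x ω) (Nat.cast_nonneg (α := ℝ) M')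
    have h2 := min_le_right (f x ω) (M' : ℝ)
    have h3 := gpos M' ω
    have h4 := gle M' ω
    exact abs_le.2 ⟨by linarith, by linarith⟩
  have h1 := (hw M _ hZ ⟨_, hZb⟩).sub_const
    (∫ ω, g M ω * (min (f x ω) (M' : ℝ) - g M' ω) ∂μ)
  rw [sub_self] at h1
  have h2 := hw M (fun _ => 1) measurable_const ⟨1, fun ω => by simp⟩
  simp only [mul_one] at h2
  have h3 := (h2.sub_const (∫ ω, g M ω ∂μ)).abs
  rw [sub_self, abs_zero] at h3
  filter_upwards [h1.eventually_le_const hpow, h3.eventually_le_const hpow] with y hy1 hy2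
  refine ⟨?_, hy2⟩
  rw [← integral_sub ((hmi y).mul_bdd hZ.aestronglyMeasurable (ae_of_all _ hZb))
    (hgi.mul_bdd hZ.aestronglyMeasurable (ae_of_all _ hZb))] at hy1
  refine le_of_eq_of_le (integral_congr_ae (ae_of_all _ fun ω => ?_)) hy1
  ring

theorem isAlmostOrthogonal_of_weak_limit {Ω : Type*} [MeasurableSpace Ω] {μ : Measure Ω}
    {f g : ℕ → Ω → ℝ} (hmeas : ∀ n, Measurable (f n))
    (hpos : ∀ n ω, 0 ≤ f n ω) (gmeas : ∀ M, Measurable (g M)) (gpos : ∀ M ω, 0 ≤ g M ω)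
    (gle : ∀ (M : ℕ) ω, g M ω ≤ M) (gmono : ∀ ω, Monotone fun M => g M ω)
    {n : ℕ → ℕ} (hn : ∀ k, ∃ B ≥ k, (∀ x ≤ B, ∀ M ≤ B + 1, ∀ M' ≤ B + 1,
      ∫ ω, (min (f x ω) (M' : ℕ) - g M' ω) * (min (f (n k) ω) (M : ℕ) - g M ω) ∂μ
        ≤ (1 / 2) ^ B ∧
      |(∫ ω, min (f (n k) ω) (M : ℕ) ∂μ) - ∫ ω, g M ω ∂μ| ≤ (1 / 2) ^ B) ∧ ∀ i < k, n i ≤ B) :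
    IsAlmostOrthogonal μ (fun k => f (n k)) g where
  measurable_X k := hmeas _
  X_nonneg k := hpos _
  measurable_g := gmeas
  g_nonneg := gpos
  g_le := gle
  g_mono := gmono
  cross i k hik M hM M' hM' := by
    obtain ⟨B, hB, h1, h2⟩ := hn k
    exact (h1 _ (h2 i hik) M (by omega) M' (by omega)).1.trans
      (pow_le_pow_of_le_one (by norm_num) (by norm_num) hB)
  mean k M hM := by
    obtain ⟨B, hB, h1, -⟩ := hn k
    exact (h1 0 (Nat.zero_le B) M (by omega) M (by omega)).2.trans
      (pow_le_pow_of_le_one (by norm_num) (by norm_num) hB)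

/-- A sequence of reals whose truncated averages exceed every level has averages tending to `∞`. -/
theorem tendsto_ofReal_average_top {x : ℕ → ℝ} {g : ℕ → ℝ}
    (hg : ⨆ M, ENNReal.ofReal (g M) = ∞)
    (h : ∀ M : ℕ, Tendsto (fun K : ℕ => (∑ k ∈ range K, min (x k) ((min M (k + 1) : ℕ) : ℝ)) / K)
      atTop (𝓝 (g M))) :
    Tendsto (fun K : ℕ => ENNReal.ofReal ((∑ k ∈ range K, x k) / K)) atTop (𝓝 ∞) := by
  rw [tendsto_order]
  refine ⟨fun a ha => ?_, fun a ha => absurd ha not_top_lt⟩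
  rw [← hg] at ha
  obtain ⟨M, hM⟩ := lt_iSup_iff.1 ha
  filter_upwards [((ENNReal.continuous_ofReal.tendsto _).comp (h M)).eventually_const_lt hM]
    with K hK
  refine hK.trans_le (ENNReal.ofReal_le_ofReal ?_)
  exact div_le_div_of_nonneg_right (sum_le_sum fun k _ => min_le_left _ _) (Nat.cast_nonneg K)

/-- **von Weizsäcker's theorem.** For any sequence of nonnegative measurable functions
on a probability space, there exist a measurable function `fstar : Ω → [0,∞]` and a
strictly increasing sequence of indices such that the corresponding subsequence converges
hereditarily in Cesàro mean to `fstar`, `P`-a.e. -/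
theorem vonWeizsaecker {Ω : Type*} [MeasurableSpace Ω] (P : Measure Ω)
    [IsProbabilityMeasure P] (f : ℕ → Ω → ℝ)
    (hmeas : ∀ n, Measurable (f n)) (hpos : ∀ n ω, 0 ≤ f n ω) :
    ∃ fstar : Ω → ℝ≥0∞, Measurable fstar ∧
      ∃ n : ℕ → ℕ, StrictMono n ∧
        ∀ φ : ℕ → ℕ, StrictMono φ →
          ∀ᵐ ω ∂P, Tendsto
            (fun K : ℕ => ENNReal.ofReal ((∑ k ∈ Finset.range K, f (n (φ k)) ω) / K))
            atTop (nhds (fstar ω)) := by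
  obtain ⟨g, ψ, hψ, gmeas, gpos, gle, gmono, hweak⟩ := exists_weak_limit_truncations P f hmeas hpos
  set G : Ω → ℝ≥0∞ := fun ω => ⨆ M, ENNReal.ofReal (g M ω)
  have hGm : Measurable G := Measurable.iSup fun M => (gmeas M).ennreal_ofReal
  set w : Ω → ℝ≥0∞ := fun ω => (1 + G ω)⁻¹
  have hwm : Measurable w := (measurable_const.add hGm).inv
  have hw1 : ∀ ω, w ω ≤ 1 := fun ω => ENNReal.inv_le_one.2 le_self_add
  have hwtop : ∀ ω, w ω < ∞ := fun ω => (hw1 ω).trans_lt ENNReal.one_lt_top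
  have hw0 : ∀ ω, w ω ≠ 0 ↔ G ω ≠ ∞ := fun ω => by simp [w]
  set Q : Measure Ω := P.withDensity w
  have hQfin : IsFiniteMeasure Q := isFiniteMeasure_withDensity
    ((lintegral_mono hw1).trans_lt (by simp)).ne
  have hQint : ∀ F : Ω → ℝ, ∫ ω, F ω ∂Q = ∫ ω, (w ω).toReal * F ω ∂P := fun F =>
    integral_withDensity_eq_integral_toReal_smul hwm (ae_of_all _ hwtop) F
  have hweakQ : ∀ (M : ℕ) (h : Ω → ℝ), Measurable h → (∃ C, ∀ ω, |h ω| ≤ C) →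
      Tendsto (fun n => ∫ ω, min (f (ψ n) ω) M * h ω ∂Q) atTop (𝓝 (∫ ω, g M ω * h ω ∂Q)) := by
    rintro M h hh ⟨C, hC⟩
    simp_rw [hQint, mul_left_comm]
    refine hweak M _ (hwm.ennreal_toReal.mul hh) ⟨C, fun ω => ?_⟩
    rw [abs_mul, abs_of_nonneg ENNReal.toReal_nonneg]
    have h1 : (w ω).toReal ≤ 1 := ENNReal.toReal_le_of_le_ofReal zero_le_one (by simpa using hw1 ω)
    exact (mul_le_of_le_one_left (abs_nonneg _) h1).trans (hC ω)
  have hgQ : ∀ M, ∫ ω, g M ω ∂Q ≤ 1 := by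
    intro M
    rw [hQint]
    have hle : ∀ ω, (w ω).toReal * g M ω ≤ 1 := by
      intro ω
      rw [← ENNReal.toReal_ofReal (gpos M ω), ← ENNReal.toReal_mul]
      refine ENNReal.toReal_le_of_le_ofReal zero_le_one ?_
      rw [ENNReal.ofReal_one]
      calc w ω * ENNReal.ofReal (g M ω) ≤ (1 + G ω)⁻¹ * (1 + G ω) := by
            gcongr
            exact (le_iSup (fun M => ENNReal.ofReal (g M ω)) M).trans le_add_self
        _ ≤ 1 := ENNReal.inv_mul_le_one _
    calc _ ≤ ∫ ω, (1 : ℝ) ∂P := by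
          refine integral_mono_of_nonneg
            (ae_of_all _ fun ω => mul_nonneg ENNReal.toReal_nonneg (gpos M ω))
            (integrable_const _) (ae_of_all _ hle)
      _ = 1 := by simp
  obtain ⟨m, hm, hmB⟩ := exists_strictMono_of_forall_eventually fun B =>
    (eventually_almost_orthogonal (fun n => hmeas (ψ n)) (fun n => hpos (ψ n)) gmeas gpos gle
      hweak B).and
    (eventually_almost_orthogonal (fun n => hmeas (ψ n)) (fun n => hpos (ψ n)) gmeas gpos gle
      hweakQ B)
  have hP : IsAlmostOrthogonal P (fun k => f (ψ (m k))) g :=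
    isAlmostOrthogonal_of_weak_limit (fun n => hmeas (ψ n)) (fun n => hpos (ψ n)) gmeas gpos gle
      gmono fun k => (hmB k).imp fun B h => ⟨h.1, h.2.1.1, h.2.2⟩
  have hQ : IsAlmostOrthogonal Q (fun k => f (ψ (m k))) g :=
    isAlmostOrthogonal_of_weak_limit (fun n => hmeas (ψ n)) (fun n => hpos (ψ n)) gmeas gpos gle
      gmono fun k => (hmB k).imp fun B h => ⟨h.1, h.2.1.2, h.2.2⟩
  have hGlim : ∀ ω, G ω ≠ ∞ → Tendsto (fun M => g M ω) atTop (𝓝 (G ω).toReal) := by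
    intro ω hω
    have h1 := (ENNReal.tendsto_toReal hω).comp (tendsto_atTop_iSup
      fun a b hab => ENNReal.ofReal_le_ofReal (gmono ω hab))
    simpa [Function.comp_def, gpos] using h1
  refine ⟨G, hGm, fun k => ψ (m k), hψ.comp hm, fun φ hφ => ?_⟩
  have h1 := ae_all_iff.2 fun M => (hP.comp hφ).ae_tendsto_average_min_const M
  have h2 := (ae_withDensity_iff hwm).1 <| (hQ.comp hφ).ae_tendsto_average hgQ
    (G := fun ω => (G ω).toReal)
    ((ae_withDensity_iff hwm).2 (ae_of_all _ fun ω hω => hGlim ω ((hw0 ω).1 hω)))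
  filter_upwards [h1, h2] with ω ha hb
  by_cases hω : G ω = ∞
  · rw [hω]
    exact tendsto_ofReal_average_top hω ha
  · have h3 := (ENNReal.continuous_ofReal.tendsto _).comp (hb ((hw0 ω).2 hω))
    rwa [ENNReal.ofReal_toReal hω] at h3
end

section
/- (Komlós) Let {f_n} be a sequence of real-valued measurable functions on a probability space (Ω, F, P) that is bounded in L¹, i.e. sup_{n} E(|f_n|) < ∞. Then there exist an integrable function f* : Ω → ℝ and a strictly increasing sequence of indices n_1 < n_2 < ⋯ such that the subsequence {f_{n_k}} converges hereditarily in Cesàro mean to f*, P-a.e. -/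
open MeasureTheory Filter Finset

/-- A bounded sequence in a real Hilbert space converges weakly along every ultrafilter. -/
lemma exists_weak_limit_inner {H : Type*} [NormedAddCommGroup H] [InnerProductSpace ℝ H]
    [CompleteSpace H] {ι : Type*} (U : Ultrafilter ι) (u : ι → H) (R : ℝ)
    (hu : ∀ n, ‖u n‖ ≤ R) :
    ∃ g : H, ∀ h : H, Tendsto (fun n => inner ℝ (u n) h) U (nhds (inner ℝ g h)) := by
  let v : ι → WeakDual ℝ H := fun n => StrongDual.toWeakDual (InnerProductSpace.toDual ℝ H (u n))
  obtain ⟨x, -, hx⟩ := (WeakDual.isCompact_closedBall (𝕜 := ℝ) (E := H) 0 R).ultrafilter_le_nhds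
    (U.map v) (by
      simp only [le_principal_iff, Ultrafilter.mem_coe, Ultrafilter.mem_map]
      refine univ_mem' fun n => ?_
      simpa [v] using hu n)
  refine ⟨(InnerProductSpace.toDual ℝ H).symm (WeakDual.toStrongDual x), fun h => ?_⟩
  have hv : Tendsto v U (nhds x) := hx
  have := ((WeakDual.eval_continuous (𝕜 := ℝ) h).tendsto x).comp hv
  rw [← InnerProductSpace.toDual_apply_apply, LinearIsometryEquiv.apply_symm_apply]
  exact this

/-- A uniformly bounded sequence of functions converges weakly in `L²` along every ultrafilter. -/
lemma exists_weak_limit_of_bounded {Ω : Type*} [MeasurableSpace Ω] (P : Measure Ω)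
    [IsProbabilityMeasure P] {ι : Type*} (U : Ultrafilter ι) (u : ι → Ω → ℝ) (R : ℝ)
    (hm : ∀ n, Measurable (u n)) (hu : ∀ n ω, ‖u n ω‖ ≤ R) :
    ∃ g : Ω → ℝ, MemLp g 2 P ∧ ∀ h : Ω → ℝ, MemLp h 2 P →
      Tendsto (fun n => ∫ ω, u n ω * h ω ∂P) U (nhds (∫ ω, g ω * h ω ∂P)) := by
  have hL (n : ι) : MemLp (u n) 2 P :=
    MemLp.of_bound (hm n).aestronglyMeasurable R (ae_of_all _ (hu n))
  have hinner {a b : Ω → ℝ} (ha : MemLp a 2 P) (hb : MemLp b 2 P) :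
      inner ℝ (ha.toLp a) (hb.toLp b) = ∫ ω, a ω * b ω ∂P := by
    rw [L2.inner_def]
    refine integral_congr_ae ?_
    filter_upwards [ha.coeFn_toLp, hb.coeFn_toLp] with ω h1 h2
    simp [h1, h2, mul_comm]
  obtain ⟨g, hg⟩ := exists_weak_limit_inner U (fun n => (hL n).toLp (u n)) (max R 0) (fun n => by
    refine (Lp.norm_le_of_ae_bound (le_max_right R 0) ?_).trans
      (by simp [measureUnivNNReal])
    filter_upwards [(hL n).coeFn_toLp] with ω h1
    rw [h1]
    exact (hu n ω).trans (le_max_left _ _))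
  refine ⟨g, Lp.memLp g, fun h hh => ?_⟩
  have := hg (hh.toLp h)
  simp_rw [hinner] at this
  rwa [← Lp.toLp_coeFn g (Lp.memLp g), hinner] at this

/-- Weak limits preserve almost everywhere inequalities. -/
lemma ae_le_of_weak_limit {Ω : Type*} [MeasurableSpace Ω] (P : Measure Ω)
    [IsProbabilityMeasure P] {ι : Type*} (U : Ultrafilter ι) {u v : ι → Ω → ℝ} {g g' : Ω → ℝ}
    (hu : ∀ n, MemLp (u n) 2 P) (hv : ∀ n, MemLp (v n) 2 P)
    (hg : MemLp g 2 P) (hg' : MemLp g' 2 P) (huv : ∀ n ω, u n ω ≤ v n ω)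
    (hug : ∀ h : Ω → ℝ, MemLp h 2 P →
      Tendsto (fun n => ∫ ω, u n ω * h ω ∂P) U (nhds (∫ ω, g ω * h ω ∂P)))
    (hvg : ∀ h : Ω → ℝ, MemLp h 2 P →
      Tendsto (fun n => ∫ ω, v n ω * h ω ∂P) U (nhds (∫ ω, g' ω * h ω ∂P))) :
    g ≤ᵐ[P] g' := by
  refine ae_le_of_forall_setIntegral_le (hg.integrable one_le_two) (hg'.integrable one_le_two)
    fun s hs _ => ?_
  have key (a : Ω → ℝ) : ∫ ω, a ω * s.indicator (fun _ => (1 : ℝ)) ω ∂P = ∫ ω in s, a ω ∂P := by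
    rw [← integral_indicator hs]
    congr 1
    ext ω
    by_cases hω : ω ∈ s <;> simp [hω]
  have hs2 : MemLp (s.indicator (fun _ => (1 : ℝ))) 2 P := (memLp_const 1).indicator hs
  have h1 := hug _ hs2
  have h2 := hvg _ hs2
  simp only [key] at h1 h2
  exact le_of_tendsto_of_tendsto' h1 h2 fun n =>
    integral_mono ((hu n).integrable one_le_two).integrableOn
      ((hv n).integrable one_le_two).integrableOn (huv n)

/-- Nonnegative functions whose integrals have bounded partial sums tend to `0` a.e. -/
lemma ae_tendsto_zero_of_sum_integral_le {Ω : Type*} [MeasurableSpace Ω] {P : Measure Ω}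
    (h : ℕ → Ω → ℝ) (hi : ∀ j, Integrable (h j) P) (h0 : ∀ j ω, 0 ≤ h j ω) (M : ℝ)
    (hM : ∀ N, ∑ j ∈ range N, ∫ ω, h j ω ∂P ≤ M) :
    ∀ᵐ ω ∂P, Tendsto (fun j => h j ω) atTop (nhds 0) := by
  have hm (j : ℕ) : AEMeasurable (fun ω => ENNReal.ofReal (h j ω)) P :=
    (hi j).aestronglyMeasurable.aemeasurable.ennreal_ofReal
  have hfin : ∫⁻ ω, ∑' j, ENNReal.ofReal (h j ω) ∂P ≠ ⊤ := by
    rw [lintegral_tsum hm]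
    refine ne_top_of_le_ne_top (ENNReal.ofReal_ne_top (r := M))
      (ENNReal.tsum_le_of_sum_range_le fun N => ?_)
    simp_rw [← ofReal_integral_eq_lintegral_ofReal (hi _) (ae_of_all _ (h0 _))]
    rw [← ENNReal.ofReal_sum_of_nonneg fun j _ => integral_nonneg (h0 j)]
    exact ENNReal.ofReal_le_ofReal (hM N)
  filter_upwards [ae_lt_top' (AEMeasurable.tsum hm) hfin] with ω hω
  have := (ENNReal.tendsto_toReal ENNReal.zero_ne_top).comp
    (ENNReal.tendsto_atTop_zero_of_tsum_ne_top hω.ne)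
  simpa [Function.comp_def, ENNReal.toReal_ofReal (h0 _ ω)] using this

/-- An a.e. monotone, nonnegative sequence bounded in `L¹` converges a.e. to an integrable
function. -/
lemma exists_integrable_limit_of_monotone {Ω : Type*} [MeasurableSpace Ω] {P : Measure Ω}
    (g : ℕ → Ω → ℝ) (hi : ∀ l, Integrable (g l) P) (h0 : ∀ l, 0 ≤ᵐ[P] g l)
    (hmono : ∀ l, g l ≤ᵐ[P] g (l + 1)) (C : ℝ) (hC : ∀ l, ∫ ω, g l ω ∂P ≤ C) :
    ∃ F : Ω → ℝ, Integrable F P ∧ ∀ᵐ ω ∂P, Tendsto (fun l => g l ω) atTop (nhds (F ω)) := by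
  have hm (l : ℕ) : AEMeasurable (fun ω => ENNReal.ofReal (g l ω)) P :=
    (hi l).aestronglyMeasurable.aemeasurable.ennreal_ofReal
  have hmono' : ∀ᵐ ω ∂P, Monotone fun l => ENNReal.ofReal (g l ω) := by
    filter_upwards [ae_all_iff.2 hmono] with ω hω
    exact monotone_nat_of_le_succ fun l => ENNReal.ofReal_le_ofReal (hω l)
  have hfin : ∫⁻ ω, ⨆ l, ENNReal.ofReal (g l ω) ∂P ≠ ⊤ := by
    rw [lintegral_iSup' hm hmono']
    refine ne_top_of_le_ne_top (ENNReal.ofReal_ne_top (r := C)) (iSup_le fun l => ?_)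
    rw [← ofReal_integral_eq_lintegral_ofReal (hi l) (h0 l)]
    exact ENNReal.ofReal_le_ofReal (hC l)
  refine ⟨fun ω => (⨆ l, ENNReal.ofReal (g l ω)).toReal,
    integrable_toReal_of_lintegral_ne_top (AEMeasurable.iSup hm) hfin, ?_⟩
  filter_upwards [ae_lt_top' (AEMeasurable.iSup hm) hfin, hmono', ae_all_iff.2 h0]
    with ω h1 h2 h3
  have := (ENNReal.tendsto_toReal h1.ne).comp (tendsto_atTop_iSup h2)
  refine this.congr fun l => ?_
  simp [ENNReal.toReal_ofReal (h3 l)]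

lemma sum_min_sq_div_sq_le (x : ℝ) (hx : 0 ≤ x) (N : ℕ) :
    ∑ l ∈ range N, (min x ((l : ℝ) + 1)) ^ 2 / ((l : ℝ) + 1) ^ 2 ≤ 3 * x := by
  suffices H : ((N : ℝ) ≤ x →
        ∑ l ∈ range N, (min x ((l : ℝ) + 1)) ^ 2 / ((l : ℝ) + 1) ^ 2 ≤ (N : ℝ)) ∧
      (x < N → ∑ l ∈ range N, (min x ((l : ℝ) + 1)) ^ 2 / ((l : ℝ) + 1) ^ 2 ≤
        3 * x - x ^ 2 / (N : ℝ)) by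
    rcases le_or_gt (N : ℝ) x with h | h
    · linarith [H.1 h]
    · have : 0 ≤ x ^ 2 / (N : ℝ) := by positivity
      linarith [H.2 h]
  induction N with
  | zero => exact ⟨by simp, fun h => absurd h (by simpa using hx)⟩
  | succ N ih =>
    have hN : (0 : ℝ) ≤ N := N.cast_nonneg
    simp only [sum_range_succ, Nat.cast_add, Nat.cast_one]
    refine ⟨fun h => ?_, fun h => ?_⟩
    · rw [min_eq_right h, div_self (by positivity)]
      linarith [ih.1 (by linarith)]
    · rw [min_eq_left h.le]
      rcases le_or_gt (N : ℝ) x with h' | h'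
      · have h1 := ih.1 h'
        have h2 : x ^ 2 / ((N : ℝ) + 1) ≤ x := by
          rw [div_le_iff₀ (by positivity)]
          nlinarith
        have h3 : x ^ 2 / ((N : ℝ) + 1) ^ 2 ≤ x := by
          rw [div_le_iff₀ (by positivity)]
          nlinarith [mul_nonneg hx hN, mul_nonneg (mul_nonneg hx hN) hN]
        linarith
      · have h1 := ih.2 h'
        have hN' : (0 : ℝ) < N := hx.trans_lt h'
        have h2 : x ^ 2 / ((N : ℝ) + 1) ^ 2 ≤ x ^ 2 / N - x ^ 2 / (N + 1) := by
          rw [div_sub_div _ _ hN'.ne' (by positivity), div_le_div_iff₀ (by positivity)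
            (by positivity)]
          nlinarith [mul_nonneg (sq_nonneg x) (by positivity : (0 : ℝ) ≤ N + 1)]
        linarith

/-- Diagonal selection of a subsequence along a filter `U ≤ atTop`. -/
lemma exists_strictMono_selection (U : Filter ℕ) [U.NeBot] (hU : U ≤ atTop)
    (p : ℕ → ℕ → Prop) (q : ℕ → ℕ → ℕ → ℕ → ℕ → Prop)
    (hp : ∀ l, ∀ᶠ y in U, p l y) (hq : ∀ i j x l, ∀ᶠ y in U, q i j x l y) :
    ∃ n : ℕ → ℕ, StrictMono n ∧ (∀ m, ∀ l ≤ m, p l (n m)) ∧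
      ∀ i m, i < m → ∀ j ≤ i, ∀ l ≤ m, q i j (n i) l (n m) := by
  obtain ⟨s, hs, hr⟩ := exists_seq_of_forall_finset_exists (α := ℕ × ℕ)
    (fun a => ∀ l ≤ a.1, p l a.2)
    (fun a b => a.1 < b.1 ∧ a.2 < b.2 ∧
      ∀ i ≤ a.1, ∀ j ≤ a.1, ∀ l ≤ b.1, q i j a.2 l b.2) (by
    intro s _
    set m := s.sup Prod.fst + 1
    have h1 : ∀ᶠ y in U, ∀ l ∈ Set.Iic m, p l y :=
      (Set.finite_Iic m).eventually_all.2 fun l _ => hp l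
    have h2 : ∀ᶠ y in U, ∀ a ∈ s, a.2 < y :=
      s.eventually_all.2 fun a _ => hU (eventually_gt_atTop a.2)
    have h3 : ∀ᶠ y in U, ∀ a ∈ s, ∀ i ∈ Set.Iic a.1, ∀ j ∈ Set.Iic a.1, ∀ l ∈ Set.Iic m,
        q i j a.2 l y :=
      s.eventually_all.2 fun a _ => (Set.finite_Iic _).eventually_all.2 fun i _ =>
        (Set.finite_Iic _).eventually_all.2 fun j _ =>
          (Set.finite_Iic _).eventually_all.2 fun l _ => hq i j a.2 l
    obtain ⟨y, h1, h2, h3⟩ := (h1.and (h2.and h3)).exists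
    exact ⟨(m, y), h1, fun a ha =>
      ⟨Nat.lt_succ_of_le (le_sup (f := Prod.fst) ha), h2 a ha, h3 a ha⟩⟩)
  have hmono : StrictMono fun k => (s k).1 := fun a b hab => (hr a b hab).1
  refine ⟨fun k => (s k).2, fun a b hab => (hr a b hab).2.1,
    fun m l hl => hs m l (hl.trans (hmono.id_le m)), fun i m him j hj l hl => ?_⟩
  exact (hr i m him).2.2 i (hmono.id_le i) j (hj.trans (hmono.id_le i)) l
    (hl.trans (hmono.id_le m))

lemma sum_one_div_succ_sq_le (N : ℕ) : ∑ k ∈ range N, 1 / ((k : ℝ) + 1) ^ 2 ≤ 3 := by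
  have h := sum_min_sq_div_sq_le 1 zero_le_one N
  simpa using h

/-- Second moment bound for sums of almost orthogonal functions. -/
lemma integral_sum_sq_le {Ω : Type*} [MeasurableSpace Ω] {P : Measure Ω}
    (X : ℕ → Ω → ℝ) (hX : ∀ k, MemLp (X k) 2 P) (b δ : ℕ → ℝ) (D : ℝ)
    (hb : ∀ k, ∫ ω, X k ω ^ 2 ∂P ≤ b k)
    (hδ : ∀ k l, k < l → |∫ ω, X l ω * X k ω ∂P| ≤ δ k)
    (hD : ∀ N, ∑ k ∈ range N, δ k ≤ D) (K : ℕ) :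
    ∫ ω, (∑ k ∈ range K, X k ω) ^ 2 ∂P ≤ ∑ k ∈ range K, (b k + 2 * D) := by
  induction K with
  | zero => simp
  | succ K ih =>
    have hS : MemLp (fun ω => ∑ k ∈ range K, X k ω) 2 P := memLp_finsetSum _ fun k _ => hX k
    have hmul (k : ℕ) : Integrable (fun ω => X K ω * X k ω) P := (hX K).integrable_mul (hX k)
    have hexp (ω : Ω) : (∑ k ∈ range (K + 1), X k ω) ^ 2 =
        (∑ k ∈ range K, X k ω) ^ 2 + 2 * ∑ k ∈ range K, X K ω * X k ω + X K ω ^ 2 := by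
      rw [sum_range_succ, ← mul_sum]
      ring
    have hcross : Integrable (fun ω => 2 * ∑ k ∈ range K, X K ω * X k ω) P :=
      (integrable_finsetSum _ fun k _ => hmul k).const_mul 2
    simp_rw [hexp]
    have hadd : Integrable (fun ω => (∑ k ∈ range K, X k ω) ^ 2 +
        2 * ∑ k ∈ range K, X K ω * X k ω) P := hS.integrable_sq.add hcross
    rw [integral_add hadd (hX K).integrable_sq,
      integral_add hS.integrable_sq hcross, integral_const_mul,
      integral_finsetSum _ fun k _ => hmul k, sum_range_succ]
    have : ∑ k ∈ range K, ∫ ω, X K ω * X k ω ∂P ≤ D :=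
      (sum_le_sum fun k hk => (le_abs_self _).trans (hδ k K (mem_range.1 hk))).trans (hD K)
    linarith [hb K]

/-- Normalised sums tend to `0` a.e. along geometric subsequences of indices. -/
lemma ae_tendsto_div_floor_pow {Ω : Type*} [MeasurableSpace Ω] {P : Measure Ω}
    (S : ℕ → Ω → ℝ) (hS : ∀ K, MemLp (S K) 2 P) (b : ℕ → ℝ) (hb0 : ∀ k, 0 ≤ b k) (B : ℝ)
    (hSb : ∀ K, ∫ ω, S K ω ^ 2 ∂P ≤ ∑ k ∈ range K, b k)
    (hB : ∀ N, ∑ k ∈ range N, b k / ((k : ℝ) + 1) ^ 2 ≤ B) (c : ℝ) (hc : 1 < c) :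
    ∀ᵐ ω ∂P, Tendsto (fun j : ℕ => S ⌊c ^ j⌋₊ ω / (⌊c ^ j⌋₊ : ℝ)) atTop (nhds 0) := by
  have hcpos : 0 < c - 1 := by linarith
  set A : ℝ := c ^ 5 * (c - 1)⁻¹ ^ 3 with hA
  have hA0 : 0 ≤ A := by positivity
  have key := ae_tendsto_zero_of_sum_integral_le
    (fun (j : ℕ) ω => S ⌊c ^ j⌋₊ ω ^ 2 * (1 / (⌊c ^ j⌋₊ : ℝ) ^ 2))
    (fun j => (hS _).integrable_sq.mul_const _) (fun j ω => by positivity) (4 * A * B) (by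
    intro N
    set M := ⌊c ^ N⌋₊
    have hKM (j : ℕ) (hj : j ∈ range N) : ⌊c ^ j⌋₊ ≤ M :=
      Nat.floor_mono (pow_le_pow_right₀ hc.le (mem_range.1 hj).le)
    calc ∑ j ∈ range N, ∫ ω, S ⌊c ^ j⌋₊ ω ^ 2 * (1 / (⌊c ^ j⌋₊ : ℝ) ^ 2) ∂P
        ≤ ∑ j ∈ range N, ∑ k ∈ range M,
            if k < ⌊c ^ j⌋₊ then b k * (1 / (⌊c ^ j⌋₊ : ℝ) ^ 2) else 0 := by
          refine sum_le_sum fun j hj => ?_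
          rw [integral_mul_const, ← sum_filter, ← sum_mul]
          refine mul_le_mul_of_nonneg_right ((hSb _).trans (le_of_eq ?_)) (by positivity)
          refine sum_congr ?_ fun _ _ => rfl
          ext k
          have := hKM j hj
          simp only [mem_range, mem_filter]
          omega
      _ = ∑ k ∈ range M, b k * ∑ j ∈ range N with k < ⌊c ^ j⌋₊, 1 / (⌊c ^ j⌋₊ : ℝ) ^ 2 := by
          rw [sum_comm]
          refine sum_congr rfl fun k _ => ?_
          rw [mul_sum, sum_filter]
      _ ≤ ∑ k ∈ range M, 4 * A * (b k / ((k : ℝ) + 1) ^ 2) := by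
          refine sum_le_sum fun k _ => ?_
          have h1 := sum_div_nat_floor_pow_sq_le_div_sq N
            (by positivity : (0 : ℝ) < (k : ℝ) + 1 / 2) hc
          have h2 : (range N).filter (fun j => k < ⌊c ^ j⌋₊) ⊆
              (range N).filter (fun j => (k : ℝ) + 1 / 2 < (⌊c ^ j⌋₊ : ℝ)) := by
            refine monotone_filter_right _ fun j _ hj => ?_
            have : (k : ℝ) + 1 ≤ (⌊c ^ j⌋₊ : ℝ) := by exact_mod_cast hj
            linarith
          have h3 := (sum_le_sum_of_subset_of_nonneg h2 fun j _ _ =>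
            (by positivity : (0 : ℝ) ≤ 1 / (⌊c ^ j⌋₊ : ℝ) ^ 2)).trans h1
          have h4 : A / ((k : ℝ) + 1 / 2) ^ 2 ≤ 4 * A / ((k : ℝ) + 1) ^ 2 := by
            rw [div_le_div_iff₀ (by positivity) (by positivity)]
            nlinarith [mul_nonneg hA0 (Nat.cast_nonneg (α := ℝ) k),
              mul_nonneg (mul_nonneg hA0 (Nat.cast_nonneg (α := ℝ) k))
                (Nat.cast_nonneg (α := ℝ) k)]
          calc _ ≤ b k * (4 * A / ((k : ℝ) + 1) ^ 2) :=
                mul_le_mul_of_nonneg_left (h3.trans h4) (hb0 k)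
            _ = _ := by ring
      _ ≤ 4 * A * B := by
          rw [← mul_sum]
          exact mul_le_mul_of_nonneg_left (hB M) (by positivity))
  filter_upwards [key] with ω hω
  rw [tendsto_zero_iff_abs_tendsto_zero]
  have := (Real.continuous_sqrt.tendsto 0).comp hω
  simp only [Real.sqrt_zero] at this
  refine this.congr fun j => ?_
  simp only [Function.comp_def]
  rw [mul_one_div, ← div_pow, Real.sqrt_sq_eq_abs]

/-- A strong law of large numbers for nonnegative functions that become almost orthogonal after
subtracting functions `g k` converging a.e. -/
lemma ae_tendsto_average_of_almost_orthogonal_s1 {Ω : Type*} [MeasurableSpace Ω] {P : Measure Ω}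
    (Y g : ℕ → Ω → ℝ) (F : Ω → ℝ) (hY : ∀ k, MemLp (Y k) 2 P) (hg : ∀ k, MemLp (g k) 2 P)
    (hY0 : ∀ k ω, 0 ≤ Y k ω) (b δ : ℕ → ℝ) (D B : ℝ) (hb0 : ∀ k, 0 ≤ b k + 2 * D)
    (hb : ∀ k, ∫ ω, (Y k ω - g k ω) ^ 2 ∂P ≤ b k)
    (hδ : ∀ k l, k < l → |∫ ω, (Y l ω - g l ω) * (Y k ω - g k ω) ∂P| ≤ δ k)
    (hD : ∀ N, ∑ k ∈ range N, δ k ≤ D)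
    (hB : ∀ N, ∑ k ∈ range N, (b k + 2 * D) / ((k : ℝ) + 1) ^ 2 ≤ B)
    (hgF : ∀ᵐ ω ∂P, Tendsto (fun k => g k ω) atTop (nhds (F ω))) :
    ∀ᵐ ω ∂P, Tendsto (fun K : ℕ => (∑ k ∈ range K, Y k ω) / K) atTop (nhds (F ω)) := by
  have hX (k : ℕ) : MemLp (fun ω => Y k ω - g k ω) 2 P := (hY k).sub (hg k)
  have hS (K : ℕ) : MemLp (fun ω => ∑ k ∈ range K, (Y k ω - g k ω)) 2 P :=
    memLp_finsetSum _ fun k _ => hX k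
  let c : ℕ → ℝ := fun i => 1 + 1 / ((i : ℝ) + 1)
  have hc1 (i : ℕ) : 1 < c i := by
    have : (0 : ℝ) < 1 / ((i : ℝ) + 1) := by positivity
    simp only [c]
    linarith
  have hclim : Tendsto c atTop (nhds 1) := by
    simpa [c] using (tendsto_const_nhds (x := (1 : ℝ))).add tendsto_one_div_add_atTop_nhds_zero_nat
  have hlim : ∀ᵐ ω ∂P, ∀ i, Tendsto (fun j : ℕ =>
      (∑ k ∈ range ⌊c i ^ j⌋₊, (Y k ω - g k ω)) / (⌊c i ^ j⌋₊ : ℝ)) atTop (nhds 0) :=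
    ae_all_iff.2 fun i => ae_tendsto_div_floor_pow _ hS _ hb0 B
      (fun K => integral_sum_sq_le _ hX b δ D hb hδ hD K) hB (c i) (hc1 i)
  filter_upwards [hlim, hgF] with ω h1 h2
  refine tendsto_div_of_monotone_of_tendsto_div_floor_pow _ _ ?_ c hc1 hclim fun i => ?_
  · refine monotone_nat_of_le_succ fun K => ?_
    rw [sum_range_succ]
    linarith [hY0 K ω]
  · have h3 : Tendsto (fun j : ℕ => ⌊c i ^ j⌋₊) atTop atTop :=
      tendsto_nat_floor_atTop.comp (tendsto_pow_atTop_atTop_of_one_lt (hc1 i))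
    have h4 := (h1 i).add (h2.cesaro.comp h3)
    rw [zero_add] at h4
    refine h4.congr fun j => ?_
    simp only [Function.comp_def, sum_sub_distrib]
    ring

/-- Komlós' theorem for nonnegative functions. -/
lemma komlos_of_nonneg {Ω : Type*} [MeasurableSpace Ω] (P : Measure Ω)
    [IsProbabilityMeasure P] (f : ℕ → Ω → ℝ)
    (hmeas : ∀ n, Measurable (f n)) (hint : ∀ n, Integrable (f n) P) (h0 : ∀ n ω, 0 ≤ f n ω)
    (C : ℝ) (hC : ∀ n, ∫ ω, f n ω ∂P ≤ C) :
    ∃ F : Ω → ℝ, Integrable F P ∧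
      ∃ n : ℕ → ℕ, StrictMono n ∧
        ∀ φ : ℕ → ℕ, StrictMono φ →
          ∀ᵐ ω ∂P, Tendsto
            (fun K : ℕ => (∑ k ∈ range K, f (n (φ k)) ω) / K) atTop (nhds (F ω)) := by
  let U : Ultrafilter ℕ := hyperfilter ℕ
  have hU : (U : Filter ℕ) ≤ atTop := Nat.hyperfilter_le_atTop
  let T : ℕ → ℕ → Ω → ℝ := fun l n ω => min (f n ω) ((l : ℝ) + 1)
  have hT0 (l n : ℕ) (ω : Ω) : 0 ≤ T l n ω := le_min (h0 n ω) (by positivity)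
  have hTle (l n : ℕ) (ω : Ω) : T l n ω ≤ (l : ℝ) + 1 := min_le_right _ _
  have hTm (l n : ℕ) : Measurable (T l n) := (hmeas n).min measurable_const
  have hTb (l n : ℕ) (ω : Ω) : ‖T l n ω‖ ≤ (l : ℝ) + 1 := by
    rw [Real.norm_of_nonneg (hT0 l n ω)]
    exact hTle l n ω
  have hTL (l n : ℕ) : MemLp (T l n) 2 P :=
    MemLp.of_bound (hTm l n).aestronglyMeasurable _ (ae_of_all _ (hTb l n))
  -- weak limits of the truncations and their a.e. limit
  choose g hgL hgw using fun l => exists_weak_limit_of_bounded P U (T l) _ (hTm l) (hTb l)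
  have hg0 (l : ℕ) : 0 ≤ᵐ[P] g l :=
    ae_le_of_weak_limit P U (u := fun _ _ => (0 : ℝ)) (fun _ => memLp_const 0) (hTL l)
      (memLp_const 0) (hgL l) (hT0 l) (fun h _ => by simp) (hgw l)
  have hgmono (l : ℕ) : g l ≤ᵐ[P] g (l + 1) := by
    refine ae_le_of_weak_limit P U (hTL l) (hTL (l + 1)) (hgL l) (hgL (l + 1)) (fun n ω => ?_)
      (hgw l) (hgw (l + 1))
    refine min_le_min_left _ ?_
    push_cast
    linarith
  have hgC (l : ℕ) : ∫ ω, g l ω ∂P ≤ C := by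
    have h1 := hgw l (fun _ => 1) (memLp_const 1)
    simp only [mul_one] at h1
    exact le_of_tendsto' h1 fun n => (integral_mono ((hTL l n).integrable one_le_two) (hint n)
      fun ω => min_le_left _ _).trans (hC n)
  obtain ⟨F, hF, hgF⟩ := exists_integrable_limit_of_monotone g
    (fun l => (hgL l).integrable one_le_two) hg0 hgmono C hgC
  -- limits of the second moments
  have hA (l : ℕ) : ∃ a ∈ Set.Icc (0 : ℝ) (((l : ℝ) + 1) ^ 2),
      Tendsto (fun n => ∫ ω, T l n ω ^ 2 ∂P) U (nhds a) := by
    refine isCompact_Icc.ultrafilter_le_nhds (U.map fun n => ∫ ω, T l n ω ^ 2 ∂P) ?_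
    simp only [le_principal_iff, Ultrafilter.mem_coe, Ultrafilter.mem_map]
    refine univ_mem' fun n => ⟨integral_nonneg fun ω => sq_nonneg _, ?_⟩
    calc ∫ ω, T l n ω ^ 2 ∂P ≤ ∫ _, ((l : ℝ) + 1) ^ 2 ∂P :=
          integral_mono (hTL l n).integrable_sq (integrable_const _)
            fun ω => pow_le_pow_left₀ (hT0 l n ω) (hTle l n ω) 2
      _ = ((l : ℝ) + 1) ^ 2 := by simp
  choose A hA0 hAlim using hA
  have hAsum (N : ℕ) : ∑ l ∈ range N, A l / ((l : ℝ) + 1) ^ 2 ≤ 3 * C := by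
    refine le_of_tendsto' (tendsto_finsetSum _ fun l _ => (hAlim l).div_const _) fun n => ?_
    simp_rw [← integral_div]
    rw [← integral_finsetSum _ fun l _ => (hTL l n).integrable_sq.div_const _]
    calc _ ≤ ∫ ω, 3 * f n ω ∂P := by
          refine integral_mono
            (integrable_finsetSum _ fun l _ => (hTL l n).integrable_sq.div_const _)
            ((hint n).const_mul 3) fun ω => sum_min_sq_div_sq_le _ (h0 n ω) N
      _ ≤ 3 * C := by
          rw [integral_const_mul]
          linarith [hC n]
  have hXL (l n : ℕ) : MemLp (fun ω => T l n ω - g l ω) 2 P := (hTL l n).sub (hgL l)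
  obtain ⟨n, hn, hp, hq⟩ := exists_strictMono_selection (U : Filter ℕ) hU
    (fun l y => ∫ ω, T l y ω ^ 2 ∂P ≤ A l + 1 ∧ ∫ ω, (T l y ω - g l ω) ^ 2 ∂P ≤ A l + 1)
    (fun i j x l y =>
      |∫ ω, (T l y ω - g l ω) * (T j x ω - g j ω) ∂P| ≤ (1 / 2 : ℝ) ^ i)
    (fun l => by
      have hexp (y : ℕ) : ∫ ω, (T l y ω - g l ω) ^ 2 ∂P =
          ∫ ω, T l y ω ^ 2 ∂P - 2 * ∫ ω, T l y ω * g l ω ∂P + ∫ ω, g l ω * g l ω ∂P := by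
        have hTg : Integrable (fun ω => T l y ω * g l ω) P := (hTL l y).integrable_mul (hgL l)
        have hgg : Integrable (fun ω => g l ω * g l ω) P := (hgL l).integrable_mul (hgL l)
        have hsub : Integrable (fun ω => T l y ω ^ 2 - 2 * (T l y ω * g l ω)) P :=
          (hTL l y).integrable_sq.sub (hTg.const_mul 2)
        rw [← integral_const_mul, ← integral_sub (hTL l y).integrable_sq (hTg.const_mul 2),
          ← integral_add hsub hgg]
        congr 1
        ext ω
        ring
      have hlim := ((hAlim l).sub ((hgw l (g l) (hgL l)).const_mul 2)).add_const
        (∫ ω, g l ω * g l ω ∂P)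
      have hgg : 0 ≤ ∫ ω, g l ω * g l ω ∂P := integral_nonneg fun ω => mul_self_nonneg _
      filter_upwards [(hAlim l).eventually_le_const (lt_add_one (A l)),
        hlim.eventually_le_const (by linarith : _ < A l + 1)] with y h1 h2
      exact ⟨h1, (hexp y).trans_le h2⟩)
    (fun i j x l => by
      have hlim := (hgw l _ (hXL j x)).sub_const (∫ ω, g l ω * (T j x ω - g j ω) ∂P)
      rw [sub_self] at hlim
      have hev := hlim.abs.eventually_le_const
        (by simp : |(0 : ℝ)| < (1 / 2 : ℝ) ^ i)
      filter_upwards [hev] with y hy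
      have h1 : Integrable (fun ω => T l y ω * (T j x ω - g j ω)) P :=
        (hTL l y).integrable_mul (hXL j x)
      have h2 : Integrable (fun ω => g l ω * (T j x ω - g j ω)) P :=
        (hgL l).integrable_mul (hXL j x)
      rw [← integral_sub h1 h2] at hy
      simpa only [sub_mul] using hy)
  refine ⟨F, hF, n, hn, fun φ hφ => ?_⟩
  have hφk (k : ℕ) : k ≤ φ k := hφ.id_le k
  let Y : ℕ → Ω → ℝ := fun k => T k (n (φ k))
  -- the averages of the truncations converge
  have hY : ∀ᵐ ω ∂P, Tendsto (fun K : ℕ => (∑ k ∈ range K, Y k ω) / K) atTop (nhds (F ω)) := by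
    refine ae_tendsto_average_of_almost_orthogonal_s1 Y g F (fun k => hTL _ _) hgL
      (fun k => hT0 _ _) (fun k => A k + 1) (fun k => (1 / 2 : ℝ) ^ k) 2 (3 * C + 5 * 3)
      (fun k => by linarith [(hA0 k).1]) (fun k => (hp _ k (hφk k)).2)
      (fun k l hkl => ?_) sum_geometric_two_le (fun N => ?_) hgF
    · exact (hq _ _ (hφ hkl) k (hφk k) l (hφk l)).trans
        (pow_le_pow_of_le_one (by norm_num) (by norm_num) (hφk k))
    · have : ∀ k : ℕ, (A k + 1 + 2 * 2) / ((k : ℝ) + 1) ^ 2 =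
          A k / ((k : ℝ) + 1) ^ 2 + 5 * (1 / ((k : ℝ) + 1) ^ 2) := fun k => by ring
      simp_rw [this]
      rw [sum_add_distrib, ← mul_sum]
      linarith [hAsum N, sum_one_div_succ_sq_le N]
  -- the truncation is eventually inactive
  have hev : ∀ᵐ ω ∂P, Tendsto (fun k : ℕ => Y k ω ^ 2 / ((k : ℝ) + 1) ^ 2) atTop (nhds 0) := by
    refine ae_tendsto_zero_of_sum_integral_le _ (fun k => (hTL _ _).integrable_sq.div_const _)
      (fun k ω => by positivity) (3 * C + 3) fun N => ?_
    calc ∑ k ∈ range N, ∫ ω, Y k ω ^ 2 / ((k : ℝ) + 1) ^ 2 ∂P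
        ≤ ∑ k ∈ range N, (A k / ((k : ℝ) + 1) ^ 2 + 1 / ((k : ℝ) + 1) ^ 2) := by
          refine sum_le_sum fun k _ => ?_
          rw [integral_div, ← add_div]
          exact div_le_div_of_nonneg_right (hp _ k (hφk k)).1 (by positivity)
      _ ≤ 3 * C + 3 := by
          rw [sum_add_distrib]
          exact add_le_add (hAsum N) (sum_one_div_succ_sq_le N)
  filter_upwards [hY, hev] with ω h1 h2
  have h3 : Tendsto (fun k => f (n (φ k)) ω - Y k ω) atTop (nhds 0) := by
    refine tendsto_const_nhds.congr' ?_
    filter_upwards [h2.eventually_lt_const one_pos] with k hk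
    rcases le_total (f (n (φ k)) ω) ((k : ℝ) + 1) with h | h
    · simp [Y, T, min_eq_left h]
    · simp only [Y, T, min_eq_right h] at hk
      rw [div_self (by positivity)] at hk
      exact absurd hk (lt_irrefl _)
  have h4 := h1.add h3.cesaro
  rw [add_zero] at h4
  refine h4.congr fun K => ?_
  rw [sum_sub_distrib]
  ring

/-- **Komlós' theorem.** A sequence of measurable functions that is bounded in `L¹`
admits a subsequence converging hereditarily in Cesàro mean, `P`-a.e., to an integrable
function `fstar`. -/
theorem komlos {Ω : Type*} [MeasurableSpace Ω] (P : Measure Ω)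
    [IsProbabilityMeasure P] (f : ℕ → Ω → ℝ)
    (hmeas : ∀ n, Measurable (f n)) (hint : ∀ n, Integrable (f n) P)
    (C : ℝ) (hC : ∀ n, ∫ ω, |f n ω| ∂P ≤ C) :
    ∃ fstar : Ω → ℝ, Integrable fstar P ∧
      ∃ n : ℕ → ℕ, StrictMono n ∧
        ∀ φ : ℕ → ℕ, StrictMono φ →
          ∀ᵐ ω ∂P, Tendsto
            (fun K : ℕ => (∑ k ∈ Finset.range K, f (n (φ k)) ω) / K)
            atTop (nhds (fstar ω)) := by
  obtain ⟨F₁, hF₁, n₁, hn₁, h₁⟩ := komlos_of_nonneg P (fun n ω => max (f n ω) 0)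
    (fun n => (hmeas n).max measurable_const) (fun n => (hint n).pos_part)
    (fun n ω => le_max_right _ _) C fun n =>
      (integral_mono (hint n).pos_part (hint n).abs fun ω =>
        max_le (le_abs_self _) (abs_nonneg _)).trans (hC n)
  obtain ⟨F₂, hF₂, n₂, hn₂, h₂⟩ := komlos_of_nonneg P (fun n ω => max (-f (n₁ n) ω) 0)
    (fun n => (hmeas _).neg.max measurable_const) (fun n => (hint _).neg_part)
    (fun n ω => le_max_right _ _) C fun n =>
      (integral_mono (hint _).neg_part (hint _).abs fun ω =>
        max_le (neg_le_abs _) (abs_nonneg _)).trans (hC (n₁ n))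
  refine ⟨fun ω => F₁ ω - F₂ ω, hF₁.sub hF₂, n₁ ∘ n₂, hn₁.comp hn₂, fun φ hφ => ?_⟩
  filter_upwards [h₁ (n₂ ∘ φ) (hn₂.comp hφ), h₂ φ hφ] with ω a₁ a₂
  refine (a₁.sub a₂).congr fun K => ?_
  rw [← sub_div, ← sum_sub_distrib]
  congr 1
  refine sum_congr rfl fun k _ => ?_
  simp only [Function.comp_apply]
  rcases le_total (f (n₁ (n₂ (φ k))) ω) 0 with h | h
  · rw [max_eq_right h, max_eq_left (by linarith)]
    ring
  · rw [max_eq_left h, max_eq_right (by linarith)]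
    ring
end

section
/- Let {f_n} be a sequence of nonnegative measurable functions on a probability space (Ω, F, P), and for k ∈ ℕ set f_n^{(k)} := f_n · 1_{{k−1 ≤ f_n < k}}. Then there exist a strictly increasing sequence of indices n_1 < n_2 < ⋯ and, for each k ∈ ℕ, a measurable function f^{(k)} : Ω → [0, ∞) such that for every k ∈ ℕ the sequence {f_{n_j}^{(k)}}_j converges hereditarily in Cesàro mean to f^{(k)}, P-a.e.; moreover, for each fixed k, for every further subsequence the Cesàro averages also converge to f^{(k)} in L¹(P). -/
open MeasureTheory Filter Finset
open scoped ENNReal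

/-- The truncation `f^(k) = f · 1_{k-1 ≤ f < k}` of a function `f`. -/
noncomputable def trunc {Ω : Type*} (g : Ω → ℝ) (k : ℕ) : Ω → ℝ :=
  ({ω | (k : ℝ) - 1 ≤ g ω ∧ g ω < k}).indicator g

/-- An ultrafilter limit for the weak topology: bounded families in a Hilbert space converge weakly
along every ultrafilter. -/
theorem exists_tendsto_inner_of_norm_le {ι H : Type*} [NormedAddCommGroup H]
    [InnerProductSpace ℝ H] [CompleteSpace H] (U : Ultrafilter ι) (x : ι → H) (M : ℝ)
    (hx : ∀ i, ‖x i‖ ≤ M) :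
    ∃ y : H, ∀ z : H, Tendsto (fun i => inner ℝ (x i) z) U (nhds (inner ℝ y z)) := by
  let T : ι → WeakDual ℝ H := fun i =>
    WeakDual.toStrongDual.symm (InnerProductSpace.toDual ℝ H (x i))
  obtain ⟨t, -, ht⟩ := (WeakDual.isCompact_closedBall (𝕜 := ℝ) (E := H) 0 M).ultrafilter_le_nhds'
    (U.map T) (by
      refine Ultrafilter.mem_map.2 (Filter.univ_mem' fun i => ?_)
      simpa [T] using hx i)
  refine ⟨(InnerProductSpace.toDual ℝ H).symm (WeakDual.toStrongDual t), fun z => ?_⟩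
  rw [InnerProductSpace.toDual_symm_apply]
  exact ((WeakDual.eval_continuous z).tendsto t).comp (show Tendsto T U (nhds t) from ht)

/-- From countably many bounded sequences in a Hilbert space one can extract a common subsequence
which, after centering at suitable points, is almost orthogonal. -/
theorem exists_strictMono_abs_inner_sub_le {H : Type*} [NormedAddCommGroup H]
    [InnerProductSpace ℝ H] [CompleteSpace H] (x : ℕ → ℕ → H) (M : ℕ → ℝ)
    (hx : ∀ k n, ‖x k n‖ ≤ M k) :
    ∃ n : ℕ → ℕ, StrictMono n ∧ ∃ (y : ℕ → H) (C : ℕ → ℝ), ∀ k i j, i < j →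
      |inner ℝ (x k (n i) - y k) (x k (n j) - y k)| ≤ C k / (j + 1) := by
  choose y hy using fun k => exists_tendsto_inner_of_norm_le (hyperfilter ℕ) (x k) (M k) (hx k)
  have hev : ∀ k a (ε : ℝ), 0 < ε → ∀ᶠ b in (hyperfilter ℕ : Filter ℕ),
      |inner ℝ (x k a - y k) (x k b - y k)| ≤ ε := by
    intro k a ε hε
    have h := (hy k (x k a - y k)).sub_const (inner ℝ (y k) (x k a - y k))
    rw [sub_self] at h
    have h2 := h.abs
    rw [abs_zero] at h2
    filter_upwards [h2.eventually_le_const hε] with b hb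
    rwa [real_inner_comm, inner_sub_left]
  obtain ⟨p, -, hp⟩ := exists_seq_of_forall_finset_exists (fun _ : ℕ × ℕ => True)
    (fun p q => p.1 < q.1 ∧ p.2 < q.2 ∧ ∀ k ≤ q.2,
      |inner ℝ (x k p.1 - y k) (x k q.1 - y k)| ≤ 1 / ((q.2 : ℝ) + 1)) (by
    intro s _
    set j := s.sup Prod.snd + 1 with hj
    have hE : ∀ᶠ b in (hyperfilter ℕ : Filter ℕ), ∀ p ∈ s, p.1 < b ∧ ∀ k ∈ Finset.range (j + 1),
        |inner ℝ (x k p.1 - y k) (x k b - y k)| ≤ 1 / ((j : ℝ) + 1) := by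
      rw [Filter.eventually_all_finset]
      intro p _
      refine ((eventually_gt_atTop p.1).filter_mono Nat.hyperfilter_le_atTop).and ?_
      rw [Filter.eventually_all_finset]
      exact fun k _ => hev k p.1 _ (by positivity)
    obtain ⟨b, hb⟩ := hE.exists
    refine ⟨(b, j), trivial, fun p hps => ⟨(hb p hps).1, ?_, fun k hk => (hb p hps).2 k ?_⟩⟩
    · exact Nat.lt_succ_of_le (Finset.le_sup (f := Prod.snd) hps)
    · exact Finset.mem_range_succ_iff.2 hk)
  have hsnd : StrictMono fun i => (p i).2 := fun i j hij => (hp i j hij).2.1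
  refine ⟨fun i => (p i).1, fun i j hij => (hp i j hij).1, y,
    fun k => 1 + (k + 1) * (M k + ‖y k‖) ^ 2, fun k i j hij => ?_⟩
  have hj : (0 : ℝ) < j + 1 := by positivity
  rcases le_or_gt k (p j).2 with hk | hk
  · refine ((hp i j hij).2.2 k hk).trans ?_
    have h1 : (j : ℝ) ≤ (p j).2 := by exact_mod_cast hsnd.le_apply
    gcongr
    have : 0 ≤ ((k : ℝ) + 1) * (M k + ‖y k‖) ^ 2 := by positivity
    linarith
  · have hb : ∀ m, ‖x k m - y k‖ ≤ M k + ‖y k‖ := fun m =>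
      (norm_sub_le _ _).trans (by gcongr; exact hx k m)
    have h1 : (j : ℝ) ≤ k := by exact_mod_cast (hsnd.le_apply (x := j)).trans hk.le
    rw [le_div_iff₀ hj]
    have h2 : |inner ℝ (x k (p i).1 - y k) (x k (p j).1 - y k)| ≤ (M k + ‖y k‖) ^ 2 := by
      refine (abs_real_inner_le_norm _ _).trans ?_
      rw [sq]
      exact mul_le_mul (hb _) (hb _) (norm_nonneg _) ((norm_nonneg _).trans (hb 0))
    calc _ ≤ (M k + ‖y k‖) ^ 2 * ((k : ℝ) + 1) := by gcongr
      _ ≤ _ := by linarith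

/-- The partial sums of an almost orthogonal bounded sequence grow at most like a square root. -/
theorem norm_sum_range_sq_le {H : Type*} [NormedAddCommGroup H] [InnerProductSpace ℝ H]
    (h : ℕ → H) (B C : ℝ) (hB : ∀ j, ‖h j‖ ≤ B)
    (hC : ∀ i j, i < j → |inner ℝ (h i) (h j)| ≤ C / (j + 1)) (J : ℕ) :
    ‖∑ j ∈ Finset.range J, h j‖ ^ 2 ≤ (B ^ 2 + 2 * C) * J := by
  induction J with
  | zero => simp
  | succ J ih =>
    have hC0 : 0 ≤ C := by
      have := (abs_nonneg _).trans (hC 0 1 one_pos)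
      rw [le_div_iff₀ (by positivity)] at this
      simpa using this
    have h1 : inner ℝ (∑ j ∈ Finset.range J, h j) (h J) ≤ C := by
      rw [sum_inner]
      calc _ ≤ ∑ _j ∈ Finset.range J, C / ((J : ℝ) + 1) :=
            Finset.sum_le_sum fun i hi => (le_abs_self _).trans (hC i J (Finset.mem_range.1 hi))
        _ = C * (J / ((J : ℝ) + 1)) := by
            rw [Finset.sum_const, Finset.card_range, nsmul_eq_mul]; ring
        _ ≤ C * 1 := by
            gcongr
            exact div_le_one_of_le₀ (by linarith) (by positivity)
        _ = C := mul_one C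
    have h2 : ‖h J‖ ^ 2 ≤ B ^ 2 := by gcongr; exact hB J
    rw [Finset.sum_range_succ, norm_add_sq_real]
    push_cast
    linarith

/-- A sequence in `L²` with summable squared norms converges to zero almost everywhere. -/
theorem ae_tendsto_zero_of_summable_norm_sq {Ω : Type*} [MeasurableSpace Ω] {P : Measure Ω}
    (v : ℕ → Lp ℝ 2 P) (hv : Summable fun n => ‖v n‖ ^ 2) :
    ∀ᵐ ω ∂P, Tendsto (fun n => v n ω) atTop (nhds 0) := by
  have hint : ∀ n, ∫⁻ ω, ‖v n ω‖ₑ ^ 2 ∂P = ENNReal.ofReal (‖v n‖ ^ 2) := by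
    intro n
    have h := eLpNorm_nnreal_pow_eq_lintegral (f := v n) (μ := P) (p := 2) two_ne_zero
    rw [ENNReal.ofReal_pow (norm_nonneg _), ofReal_norm, Lp.enorm_def]
    simpa using h.symm
  have hmeas : ∀ n, AEMeasurable (fun ω => ‖v n ω‖ₑ ^ 2) P := fun n =>
    (Lp.aestronglyMeasurable (v n)).enorm.pow_const 2
  have hfin : ∫⁻ ω, ∑' n, ‖v n ω‖ₑ ^ 2 ∂P ≠ ⊤ := by
    rw [lintegral_tsum hmeas]
    simp_rw [hint]
    rw [← ENNReal.ofReal_tsum_of_nonneg (fun n => by positivity) hv]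
    exact ENNReal.ofReal_ne_top
  filter_upwards [ae_lt_top' (AEMeasurable.tsum hmeas) hfin] with ω hω
  have h := ENNReal.tendsto_atTop_zero_of_tsum_ne_top hω.ne
  have h2 := (ENNReal.tendsto_toReal ENNReal.zero_ne_top).comp h
  have h3 : Tendsto (fun n => √((v n ω) ^ 2)) atTop (nhds √0) := by
    refine Tendsto.sqrt ?_
    simpa [Function.comp_def] using h2
  rw [tendsto_zero_iff_abs_tendsto_zero]
  simpa [Real.sqrt_sq_eq_abs, Function.comp_def] using h3

/-- For nonnegative terms, convergence of the Cesàro averages along the squares implies convergence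
of all Cesàro averages. -/
theorem tendsto_sum_range_div_of_tendsto_sq (a : ℕ → ℝ) (l : ℝ) (ha : ∀ n, 0 ≤ a n)
    (h : Tendsto (fun K : ℕ => (∑ j ∈ Finset.range ((K + 1) ^ 2), a j) / ((K + 1) ^ 2 : ℕ))
      atTop (nhds l)) :
    Tendsto (fun J : ℕ => (∑ j ∈ Finset.range J, a j) / J) atTop (nhds l) := by
  refine tendsto_div_of_monotone_of_exists_subseq_tendsto_div _ l ?_ ?_
  · exact monotone_nat_of_le_succ fun n => by
      rw [Finset.sum_range_succ]; linarith [ha n]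
  · intro c hc
    refine ⟨fun K => (K + 1) ^ 2, ?_, ?_, h⟩
    · have h1 : Tendsto (fun K : ℕ => (1 + 1 / ((K : ℝ) + 1)) ^ 2) atTop (nhds ((1 + 0) ^ 2)) :=
        (tendsto_one_div_add_atTop_nhds_zero_nat.const_add 1).pow 2
      filter_upwards [h1.eventually_le_const (u := c) (by simpa using hc)] with K hK
      push_cast
      calc ((K : ℝ) + 1 + 1) ^ 2 = (1 + 1 / ((K : ℝ) + 1)) ^ 2 * (K + 1) ^ 2 := by
            field_simp
        _ ≤ _ := by gcongr
    · exact (tendsto_pow_atTop two_ne_zero).comp (tendsto_add_atTop_nat 1)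

/-- Cesàro averages of a nonnegative sequence in `L²` which is almost orthogonal after centering
converge almost everywhere. -/
theorem ae_tendsto_cesaro_of_abs_inner_sub_le {Ω : Type*} [MeasurableSpace Ω] {P : Measure Ω}
    (g : ℕ → Ω → ℝ) (hpos : ∀ n ω, 0 ≤ g n ω) (x : ℕ → Lp ℝ 2 P) (hxg : ∀ n, x n =ᵐ[P] g n)
    (y : Lp ℝ 2 P) (B C : ℝ) (hB : ∀ n, ‖x n - y‖ ≤ B)
    (hC : ∀ i j, i < j → |inner ℝ (x i - y) (x j - y)| ≤ C / (j + 1)) :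
    ∀ᵐ ω ∂P, Tendsto (fun J : ℕ => (∑ j ∈ Finset.range J, g j ω) / J) atTop (nhds (y ω)) := by
  let c : ℕ → ℝ := fun K => ((((K + 1) ^ 2 : ℕ) : ℝ))⁻¹
  let v : ℕ → Lp ℝ 2 P := fun K => c K • ∑ j ∈ Finset.range ((K + 1) ^ 2), (x j - y)
  have hc : ∀ K, 0 < c K := fun K => by positivity
  have hv : Summable fun K => ‖v K‖ ^ 2 := by
    have hs : Summable fun K : ℕ => (B ^ 2 + 2 * C) * c K := by
      refine Summable.mul_left _ ?_
      have := (summable_nat_add_iff 1).2 (Real.summable_nat_pow_inv.2 one_lt_two)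
      simpa [c] using this
    refine Summable.of_nonneg_of_le (fun K => by positivity) (fun K => ?_) hs
    have h := norm_sum_range_sq_le (fun j => x j - y) B C hB hC ((K + 1) ^ 2)
    rw [norm_smul, mul_pow, Real.norm_of_nonneg (hc K).le]
    calc _ ≤ c K ^ 2 * ((B ^ 2 + 2 * C) * ((K + 1) ^ 2 : ℕ)) := by gcongr
      _ = (B ^ 2 + 2 * C) * c K * (c K * ((K + 1) ^ 2 : ℕ)) := by ring
      _ = _ := by rw [inv_mul_cancel₀ (by positivity), mul_one]
  have hcoe : ∀ᵐ ω ∂P, ∀ K, v K ω = c K * (∑ j ∈ Finset.range ((K + 1) ^ 2), g j ω) - y ω := by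
    rw [ae_all_iff]
    intro K
    have hsub : ∀ᵐ ω ∂P, ∀ j, (x j - y : Lp ℝ 2 P) ω = g j ω - y ω := by
      rw [ae_all_iff]
      intro j
      filter_upwards [Lp.coeFn_sub (x j) y, hxg j] with ω h1 h2
      rw [h1, Pi.sub_apply, h2]
    filter_upwards [Lp.coeFn_smul (c K) (∑ j ∈ Finset.range ((K + 1) ^ 2), (x j - y)),
      Lp.coeFn_finsetSum (Finset.range ((K + 1) ^ 2)) (fun j => x j - y), hsub] with ω h1 h2 h3
    have h4 : c K * ((K + 1) ^ 2 : ℕ) = 1 := inv_mul_cancel₀ (by positivity)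
    rw [h1, Pi.smul_apply, h2, Finset.sum_apply, Finset.sum_congr rfl fun j _ => h3 j,
      Finset.sum_sub_distrib, Finset.sum_const, Finset.card_range, nsmul_eq_mul, smul_eq_mul,
      mul_sub, ← mul_assoc, h4, one_mul]
  filter_upwards [ae_tendsto_zero_of_summable_norm_sq v hv, hcoe] with ω h0 h1
  refine tendsto_sum_range_div_of_tendsto_sq _ _ (fun n => hpos n ω) ?_
  have h2 := h0.add_const (y ω)
  rw [zero_add] at h2
  refine h2.congr fun K => ?_
  rw [h1 K, sub_add_cancel, div_eq_inv_mul]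

/-- Countably many uniformly bounded sequences of nonnegative functions have a common subsequence
along which each of them converges hereditarily in Cesàro mean. -/
theorem exists_strictMono_hereditary_cesaro {Ω : Type*} [MeasurableSpace Ω] (P : Measure Ω)
    [IsFiniteMeasure P] (g : ℕ → ℕ → Ω → ℝ) (M : ℕ → ℝ) (hmeas : ∀ k n, Measurable (g k n))
    (hpos : ∀ k n ω, 0 ≤ g k n ω) (hle : ∀ k n ω, g k n ω ≤ M k) :
    ∃ n : ℕ → ℕ, StrictMono n ∧ ∃ F : ℕ → Ω → ℝ,
      (∀ k, Measurable (F k) ∧ (∀ ω, 0 ≤ F k ω) ∧ Integrable (F k) P) ∧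
      ∀ k (φ : ℕ → ℕ), StrictMono φ → ∀ᵐ ω ∂P, Tendsto
        (fun J : ℕ => (∑ j ∈ Finset.range J, g k (n (φ j)) ω) / J) atTop (nhds (F k ω)) := by
  have hnorm : ∀ k n ω, ‖g k n ω‖ ≤ M k := fun k n ω => by
    rw [Real.norm_of_nonneg (hpos k n ω)]; exact hle k n ω
  have hL : ∀ k n, MemLp (g k n) 2 P := fun k n =>
    MemLp.of_bound (hmeas k n).aestronglyMeasurable (M k) (ae_of_all _ (hnorm k n))
  let x : ℕ → ℕ → Lp ℝ 2 P := fun k n => (hL k n).toLp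
  have hx : ∀ k, ∃ B, ∀ n, ‖x k n‖ ≤ B := by
    intro k
    refine ⟨_, fun n => Lp.norm_le_of_ae_bound (abs_nonneg (M k)) ?_⟩
    filter_upwards [(hL k n).coeFn_toLp] with ω hω
    rw [hω]
    exact (hnorm k n ω).trans (le_abs_self _)
  choose B hB using hx
  obtain ⟨n, hn, y, C, hC⟩ := exists_strictMono_abs_inner_sub_le x B hB
  have hcon : ∀ k (φ : ℕ → ℕ), StrictMono φ → ∀ᵐ ω ∂P, Tendsto
      (fun J : ℕ => (∑ j ∈ Finset.range J, g k (n (φ j)) ω) / J) atTop (nhds (y k ω)) := by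
    intro k φ hφ
    have hC0 : 0 ≤ C k := by
      have := (abs_nonneg _).trans (hC k 0 1 one_pos)
      rw [le_div_iff₀ (by positivity)] at this
      simpa using this
    refine ae_tendsto_cesaro_of_abs_inner_sub_le (fun j => g k (n (φ j))) (fun j => hpos k _)
      (fun j => x k (n (φ j))) (fun j => (hL k _).coeFn_toLp) (y k) (B k + ‖y k‖) (C k)
      (fun j => (norm_sub_le _ _).trans (by gcongr; exact hB k _)) fun i j hij => ?_
    refine (hC k _ _ (hφ hij)).trans ?_
    have : (j : ℝ) ≤ φ j := by exact_mod_cast hφ.le_apply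
    gcongr
  have hy : ∀ k, 0 ≤ᵐ[P] y k := by
    intro k
    filter_upwards [hcon k id strictMono_id] with ω hω
    exact ge_of_tendsto' hω fun J =>
      div_nonneg (Finset.sum_nonneg fun j _ => hpos k _ ω) (Nat.cast_nonneg J)
  have hpart : ∀ k, (fun ω => max (y k ω) 0) =ᵐ[P] y k := fun k => by
    filter_upwards [hy k] with ω hω using max_eq_left hω
  refine ⟨n, hn, fun k ω => max (y k ω) 0, fun k => ⟨?_, fun ω => le_max_right _ _, ?_⟩, ?_⟩
  · exact (Lp.stronglyMeasurable (y k)).measurable.max measurable_const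
  · exact ((Lp.memLp (y k)).integrable (by norm_num)).congr (hpart k).symm
  · intro k φ hφ
    filter_upwards [hcon k φ hφ, hpart k] with ω h1 h2
    rwa [h2]

/-- Dominated convergence for Cesàro averages of a bounded sequence. -/
theorem tendsto_integral_abs_cesaro_sub {Ω : Type*} [MeasurableSpace Ω] {P : Measure Ω}
    [IsFiniteMeasure P] (g : ℕ → Ω → ℝ) (F : Ω → ℝ) (M : ℝ) (hmeas : ∀ n, Measurable (g n))
    (hM : 0 ≤ M) (hle : ∀ n ω, |g n ω| ≤ M) (hF : Integrable F P)
    (h : ∀ᵐ ω ∂P, Tendsto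
      (fun J : ℕ => (∑ j ∈ Finset.range J, g j ω) / J) atTop (nhds (F ω))) :
    Tendsto (fun J : ℕ => ∫ ω, |(∑ j ∈ Finset.range J, g j ω) / J - F ω| ∂P)
      atTop (nhds 0) := by
  rw [← integral_zero Ω ℝ (μ := P)]
  refine tendsto_integral_of_dominated_convergence (fun ω => M + |F ω|) (fun J => ?_)
    ((integrable_const M).add hF.abs) (fun J => ae_of_all _ fun ω => ?_) ?_
  · have : Measurable fun ω => (∑ j ∈ Finset.range J, g j ω) / (J : ℝ) :=
      (Finset.measurable_sum _ fun j _ => hmeas j).div_const _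
    exact (this.aestronglyMeasurable.sub hF.aestronglyMeasurable).norm
  · rw [Real.norm_eq_abs, abs_abs]
    refine (abs_sub _ _).trans ?_
    gcongr
    rw [abs_div, Nat.abs_cast]
    refine div_le_of_le_mul₀ (Nat.cast_nonneg J) hM ?_
    refine (Finset.abs_sum_le_sum_abs _ _).trans ((Finset.sum_le_sum fun j _ => hle j ω).trans ?_)
    rw [Finset.sum_const, Finset.card_range, nsmul_eq_mul, mul_comm]
  · filter_upwards [h] with ω hω
    simpa using (hω.sub_const (F ω)).abs

theorem trunc_nonneg {Ω : Type*} {g : Ω → ℝ} (hg : ∀ ω, 0 ≤ g ω) (k : ℕ) (ω : Ω) :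
    0 ≤ trunc g k ω :=
  Set.indicator_nonneg (fun ω _ => hg ω) ω

theorem trunc_le {Ω : Type*} (g : Ω → ℝ) (k : ℕ) (ω : Ω) : trunc g k ω ≤ k :=
  Set.indicator_le' (fun _ hω => hω.2.le) (fun _ _ => Nat.cast_nonneg k) ω

theorem Measurable.trunc {Ω : Type*} [MeasurableSpace Ω] {g : Ω → ℝ} (hg : Measurable g) (k : ℕ) :
    Measurable (trunc g k) :=
  hg.indicator ((measurableSet_le measurable_const hg).inter
    (measurableSet_lt hg measurable_const))

/-- For a sequence of nonnegative measurable functions there is a subsequence such that,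
for every `k ≥ 1`, the truncations `f_n^(k) = f_n · 1_{k-1 ≤ f_n < k}` converge
hereditarily in Cesàro mean `P`-a.e. to a measurable nonnegative function `f^(k)`;
moreover, for each fixed `k`, the Cesàro averages along every further subsequence also
converge to `f^(k)` in `L¹(P)`. -/
theorem trunc_hereditary_cesaro {Ω : Type*} [MeasurableSpace Ω] (P : Measure Ω)
    [IsProbabilityMeasure P] (f : ℕ → Ω → ℝ)
    (hmeas : ∀ n, Measurable (f n)) (hpos : ∀ n ω, 0 ≤ f n ω) :
    ∃ n : ℕ → ℕ, StrictMono n ∧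
      ∃ F : ℕ → Ω → ℝ,
        (∀ k, 1 ≤ k → Measurable (F k) ∧ ∀ ω, 0 ≤ F k ω) ∧
        ∀ k, 1 ≤ k →
          (∀ φ : ℕ → ℕ, StrictMono φ →
            ∀ᵐ ω ∂P, Tendsto
              (fun J : ℕ => (∑ j ∈ Finset.range J, trunc (f (n (φ j))) k ω) / J)
              atTop (nhds (F k ω))) ∧
          (∀ φ : ℕ → ℕ, StrictMono φ →
            Tendsto
              (fun J : ℕ =>
                ∫ ω, |(∑ j ∈ Finset.range J, trunc (f (n (φ j))) k ω) / J - F k ω| ∂P)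
              atTop (nhds 0)) := by
  obtain ⟨n, hn, F, hF, hcon⟩ := exists_strictMono_hereditary_cesaro P
    (fun k m => trunc (f m) k) (fun k => k) (fun k m => (hmeas m).trunc k)
    (fun k m => trunc_nonneg (hpos m) k) (fun k m => trunc_le (f m) k)
  refine ⟨n, hn, F, fun k _ => ⟨(hF k).1, (hF k).2.1⟩, fun k _ => ⟨hcon k, fun φ hφ => ?_⟩⟩
  refine tendsto_integral_abs_cesaro_sub (fun j => trunc (f (n (φ j))) k) (F k) k
    (fun j => (hmeas _).trunc k) (Nat.cast_nonneg k) (fun j ω => ?_) (hF k).2.2 (hcon k φ hφ)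
  rw [abs_of_nonneg (trunc_nonneg (hpos _) k ω)]
  exact trunc_le _ k ω
end
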